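/- arXiv:2602.04286 — 5 statements merged into one kernel-verified Lean document; each statement's English description precedes it below -/
import Mathlib

section
/- Let L be a first-order language containing a binary relation symbol <, let M be an L-structure in which < is interpreted as a dense linear order without endpoints, let I be an index set and U a non-principal ultrafilter on I. Let M* = M^(I)/U be the bounded ultrapower of M modulo U. Then for every Δ₀-formula φ(x₁,…,x_m) of L and all bounded functions f₁,…,f_m : I → M, M* ⊨ φ([f₁],…,[f_m]) if and only if { i ∈ I : M ⊨ φ(f₁(i),…,f_m(i)) } ∈ U. -/
/-!
Statement 0: Łoś's lemma for Δ₀-formulas in bounded ultrapowers.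
-/

open FirstOrder FirstOrder.Language FirstOrder.Language.Structure Filter

universe u v w x

/-- A function `f : I → M` is bounded if its values lie strictly between two
elements of `M`. -/
def IsBoundedFun {I : Type x} {M : Type w} [LT M] (f : I → M) : Prop :=
  ∃ a b : M, ∀ i, a < f i ∧ f i < b

/-- The class of `Δ₀`-formulas (bounded formulas) of a language `L` with a designated
binary relation symbol `lt` playing the role of `<`:  they are built from atomic formulas
by Boolean connectives (`⊥`, `→`, hence all of them) and bounded quantification
`∀ x ∈ (t₁, t₂)`, i.e. `∀ x ((t₁ < x ∧ x < t₂) → φ)`.  Bounded existential quantification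
`∃ x ∈ (t₁, t₂) φ` is expressible as `¬ ∀ x ∈ (t₁, t₂) ¬ φ`. -/
inductive IsDelta0 {L : FirstOrder.Language.{u, v}} {α : Type x} (lt : L.Relations 2) :
    {n : ℕ} → L.BoundedFormula α n → Prop
  | falsum {n : ℕ} : IsDelta0 lt (BoundedFormula.falsum : L.BoundedFormula α n)
  | equal {n : ℕ} (t₁ t₂ : L.Term (α ⊕ Fin n)) : IsDelta0 lt (Term.bdEqual t₁ t₂)
  | rel {n k : ℕ} (R : L.Relations k) (ts : Fin k → L.Term (α ⊕ Fin n)) :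
      IsDelta0 lt (R.boundedFormula ts)
  | imp {n : ℕ} {φ ψ : L.BoundedFormula α n} :
      IsDelta0 lt φ → IsDelta0 lt ψ → IsDelta0 lt (φ.imp ψ)
  | bddAll {n : ℕ} (t₁ t₂ : L.Term (α ⊕ Fin n)) {φ : L.BoundedFormula α (n + 1)} :
      IsDelta0 lt φ →
      IsDelta0 lt (BoundedFormula.all
        (((lt.boundedFormula₂ (t₁.relabel (Sum.map id Fin.castSucc))
              (Term.var (Sum.inr (Fin.last n)))) ⊓
          (lt.boundedFormula₂ (Term.var (Sum.inr (Fin.last n)))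
              (t₂.relabel (Sum.map id Fin.castSucc)))).imp φ))

section BoundedUltrapower

variable {L : FirstOrder.Language.{u, v}} {M : Type w} {I : Type x}

/-- A function eventually squeezed between two bounded functions is eventually equal to a
bounded function. -/
theorem IsBoundedFun.exists_eventuallyEq_of_between [LinearOrder M] {l : Filter I} [l.NeBot]
    {a b h : I → M} (ha : IsBoundedFun a) (hb : IsBoundedFun b)
    (hab : ∀ᶠ i in l, a i < h i ∧ h i < b i) :
    ∃ h' : I → M, IsBoundedFun h' ∧ h' =ᶠ[l] h := by
  classical
  obtain ⟨p, _, hp⟩ := ha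
  obtain ⟨_, q, hq⟩ := hb
  obtain ⟨j, hj⟩ := hab.exists
  refine ⟨fun i => if a i < h i ∧ h i < b i then h i else h j, ⟨p, q, fun i => ?_⟩, ?_⟩
  · dsimp only
    split_ifs with hi
    · exact ⟨(hp i).1.trans hi.1, hi.2.trans (hq i).2⟩
    · exact ⟨(hp j).1.trans hj.1, hj.2.trans (hq j).2⟩
  · filter_upwards [hab] with i hi
    exact if_pos hi

variable [L.Structure M] {u : Ultrafilter I}
  {S : L.Substructure ((u : Filter I).Product fun _ : I => M)}

/-- If `S` consists of the classes of bounded functions, then it contains the class of every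
function eventually squeezed between two functions with classes in `S`. -/
theorem coe_mem_of_between [LinearOrder M]
    (hS : (S : Set ((u : Filter I).Product fun _ : I => M)) =
      {y | ∃ f : I → M, IsBoundedFun f ∧ (f : (u : Filter I).Product fun _ : I => M) = y})
    {a b h : I → M} (ha : (a : (u : Filter I).Product fun _ : I => M) ∈ S)
    (hb : (b : (u : Filter I).Product fun _ : I => M) ∈ S)
    (hab : ∀ᶠ i in (u : Filter I), a i < h i ∧ h i < b i) :
    (h : (u : Filter I).Product fun _ : I => M) ∈ S := by
  obtain ⟨a', ha', haa'⟩ := (Set.ext_iff.1 hS _).1 ha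
  obtain ⟨b', hb', hbb'⟩ := (Set.ext_iff.1 hS _).1 hb
  have hae : ∀ᶠ i in (u : Filter I), a' i = a i := Quotient.exact haa'
  have hbe : ∀ᶠ i in (u : Filter I), b' i = b i := Quotient.exact hbb'
  obtain ⟨h', hbdd, heq⟩ := ha'.exists_eventuallyEq_of_between hb' (l := u) (h := h) (by
    filter_upwards [hab, hae, hbe] with i hi hai hbi
    rwa [hai, hbi])
  exact (Set.ext_iff.1 hS _).2 ⟨h', hbdd, Quotient.sound heq⟩

variable {α : Type*} {n : ℕ}

/-- Terms are evaluated pointwise in a substructure of an ultrapower. -/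
theorem coe_term_realize {g : α → S} {f : α → I → M}
    (hg : ∀ k, (g k : (u : Filter I).Product fun _ : I => M) = f k) (t : L.Term α) :
    ((t.realize g : S) : (u : Filter I).Product fun _ : I => M) =
      (fun i => t.realize fun k => f k i : I → M) := by
  rw [← Ultraproduct.term_realize_cast, ← realize_term_substructure]
  exact congrArg t.realize (funext hg)

/-- Łoś's theorem for quantifier-free formulas in a substructure of an ultrapower. -/
theorem FirstOrder.Language.BoundedFormula.IsQF.realize_substructure_ultrapower [Nonempty M]
    {φ : L.BoundedFormula α n} (hφ : φ.IsQF)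
    {g : α → S} {f : α → I → M} {ys : Fin n → S} {xs : Fin n → I → M}
    (hg : ∀ k, (g k : (u : Filter I).Product fun _ : I => M) = f k)
    (hys : ∀ k, (ys k : (u : Filter I).Product fun _ : I => M) = xs k) :
    φ.Realize g ys ↔
      ∀ᶠ i in (u : Filter I), φ.Realize (fun k => f k i) (fun k => xs k i) := by
  rw [← Ultraproduct.boundedFormula_realize_cast, ← hφ.realize_embedding S.subtype]
  exact iff_of_eq (congrArg₂ φ.Realize (funext hg) (funext hys))

/-- Łoś's theorem for `Δ₀`-formulas with free variables of both sorts in the bounded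
ultrapower. -/
theorem IsDelta0.realize_boundedUltrapower [LinearOrder M] [Nonempty M] {lt : L.Relations 2}
    (hlt : ∀ a b : M, Structure.RelMap lt ![a, b] ↔ a < b)
    (hS : (S : Set ((u : Filter I).Product fun _ : I => M)) =
      {y | ∃ f : I → M, IsBoundedFun f ∧ (f : (u : Filter I).Product fun _ : I => M) = y})
    {φ : L.BoundedFormula α n} (hφ : IsDelta0 lt φ)
    {g : α → S} {f : α → I → M} {ys : Fin n → S} {xs : Fin n → I → M}
    (hg : ∀ k, (g k : (u : Filter I).Product fun _ : I => M) = f k)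
    (hys : ∀ k, (ys k : (u : Filter I).Product fun _ : I => M) = xs k) :
    φ.Realize g ys ↔
      ∀ᶠ i in (u : Filter I), φ.Realize (fun k => f k i) (fun k => xs k i) := by
  induction hφ with
  | falsum => exact BoundedFormula.IsQF.falsum.realize_substructure_ultrapower hg hys
  | equal t₁ t₂ =>
    exact (BoundedFormula.IsAtomic.equal t₁ t₂).isQF.realize_substructure_ultrapower hg hys
  | rel R ts =>
    exact (BoundedFormula.IsAtomic.rel R ts).isQF.realize_substructure_ultrapower hg hys
  | imp _ _ ihφ ihψ =>
    simp only [BoundedFormula.realize_imp, ihφ hys, ihψ hys, Ultrafilter.eventually_imp]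
  | @bddAll n t₁ t₂ φ _ ih =>
    have hsnoc : ∀ {y : S} {h : I → M}, (y : (u : Filter I).Product fun _ : I => M) = h →
        ∀ k : Fin (n + 1), ((Fin.snoc ys y : Fin (n + 1) → S) k :
          (u : Filter I).Product fun _ : I => M) = (Fin.snoc xs h : Fin (n + 1) → I → M) k := by
      intro y h hy k
      refine Fin.lastCases ?_ (fun j => ?_) k
      · simpa only [Fin.snoc_last] using hy
      · simpa only [Fin.snoc_castSucc] using hys j
    have hpt : ∀ (h : I → M) (i : I),
        (fun k : Fin (n + 1) => (Fin.snoc xs h : Fin (n + 1) → I → M) k i) =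
          Fin.snoc (fun k => xs k i) (h i) := by
      intro h i
      refine funext fun k => Fin.lastCases ?_ (fun j => ?_) k
      · simp only [Fin.snoc_last]
      · simp only [Fin.snoc_castSucc]
    set guard : L.BoundedFormula α (n + 1) :=
      (lt.boundedFormula₂ (t₁.relabel (Sum.map id Fin.castSucc))
        (Term.var (Sum.inr (Fin.last n)))) ⊓
      (lt.boundedFormula₂ (Term.var (Sum.inr (Fin.last n)))
        (t₂.relabel (Sum.map id Fin.castSucc))) with hguard
    have hQF : guard.IsQF :=
      (BoundedFormula.IsAtomic.rel _ _).isQF.inf (BoundedFormula.IsAtomic.rel _ _).isQF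
    have hreal : ∀ (v : α → M) (z : Fin n → M) (c : M), guard.Realize v (Fin.snoc z c) ↔
        t₁.realize (Sum.elim v z) < c ∧ c < t₂.realize (Sum.elim v z) := by
      intro v z c
      have hz : Sum.elim v (Fin.snoc z c : Fin (n + 1) → M) ∘ Sum.map id Fin.castSucc =
          Sum.elim v z := by
        ext (k | k) <;> simp
      simp [hguard, BoundedFormula.realize_rel₂, Term.realize_relabel, hz, hlt]
    have hterm : ∀ t : L.Term (α ⊕ Fin n),
        ((fun i => t.realize (Sum.elim (fun k => f k i) fun k => xs k i) : I → M) :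
          (u : Filter I).Product fun _ : I => M) ∈ S := by
      intro t
      have hval : ∀ i, (fun k => Sum.elim f xs k i) =
          Sum.elim (fun k => f k i) fun k => xs k i := by
        intro i
        ext (k | k) <;> rfl
      have ht := coe_term_realize (g := Sum.elim g ys) (f := Sum.elim f xs)
        (by rintro (k | k); exacts [hg k, hys k]) t
      simp only [hval] at ht
      exact ht ▸ (t.realize (Sum.elim g ys)).2
    have hstep : ∀ {y : S} {h : I → M}, (y : (u : Filter I).Product fun _ : I => M) = h →
        ((guard.imp φ).Realize g (Fin.snoc ys y) ↔ ∀ᶠ i in (u : Filter I),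
          (guard.imp φ).Realize (fun k => f k i) (Fin.snoc (fun k => xs k i) (h i))) := by
      intro y h hy
      simp only [BoundedFormula.realize_imp, ih (hsnoc hy),
        hQF.realize_substructure_ultrapower hg (hsnoc hy), Ultrafilter.eventually_imp, hpt]
    simp only [BoundedFormula.realize_all]
    constructor
    · intro H
      by_contra hcon
      rw [← Ultrafilter.eventually_not] at hcon
      simp only [not_forall] at hcon
      obtain ⟨h, hh⟩ := hcon.choice
      have hmem : (h : (u : Filter I).Product fun _ : I => M) ∈ S := by
        refine coe_mem_of_between hS (hterm t₁) (hterm t₂) ?_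
        filter_upwards [hh] with i hi
        rw [BoundedFormula.realize_imp, Classical.not_imp] at hi
        exact (hreal _ _ _).1 hi.1
      obtain ⟨i, hi, hi'⟩ := (hh.and ((hstep rfl).1 (H ⟨_, hmem⟩))).exists
      exact hi hi'
    · rintro H ⟨y, hy⟩
      obtain ⟨h, rfl⟩ := Quotient.exists_rep y
      exact (hstep rfl).2 (H.mono fun i hi => hi (h i))

end BoundedUltrapower

/-- **Łoś's lemma for Δ₀-formulas in the bounded ultrapower.**
Here `L` is a language with a designated binary relation symbol `lt` interpreted in `M`
as a dense linear order `<` without endpoints, `u` is a non-principal ultrafilter on `I`,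
and the bounded ultrapower `M* = M^(I)/u` is realized as the substructure `S` of the full
ultrapower `(u : Filter I).Product (fun _ => M)` whose underlying set consists exactly of
the classes of bounded functions `I → M`.  For every `Δ₀`-formula `φ(x₁,…,x_m)` and all
bounded `f₁,…,f_m : I → M` (with classes `g₁,…,g_m ∈ M*`),
`M* ⊨ φ([f₁],…,[f_m])` iff `{i ∈ I : M ⊨ φ(f₁ i,…,f_m i)} ∈ u`. -/
theorem delta0_los_for_bounded_ultrapowers
    {L : FirstOrder.Language.{u, v}} {M : Type w} [L.Structure M]
    [LinearOrder M] [DenselyOrdered M] [NoMinOrder M] [NoMaxOrder M] [Nonempty M]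
    (lt : L.Relations 2)
    (hlt : ∀ a b : M, Structure.RelMap lt ![a, b] ↔ a < b)
    {I : Type x} (u : Ultrafilter I) (hu : ∀ i : I, (u : Filter I) ≠ pure i)
    (S : L.Substructure ((u : Filter I).Product fun _ : I => M))
    (hS : (S : Set ((u : Filter I).Product fun _ : I => M)) =
      {y | ∃ f : I → M, IsBoundedFun f ∧ (f : (u : Filter I).Product fun _ : I => M) = y})
    {m : ℕ} (φ : L.Formula (Fin m)) (hφ : IsDelta0 lt φ)
    (f : Fin m → I → M) (hf : ∀ k, IsBoundedFun (f k))
    (g : Fin m → S)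
    (hg : ∀ k, (g k : (u : Filter I).Product fun _ : I => M) =
      (f k : (u : Filter I).Product fun _ : I => M)) :
    φ.Realize g ↔ {i : I | φ.Realize fun k => f k i} ∈ u := by
  refine (hφ.realize_boundedUltrapower hlt hS (xs := default) hg finZeroElim).trans ?_
  refine iff_of_eq (congrArg (· ∈ u) (Set.ext fun i => ?_))
  exact iff_of_eq (congrArg (BoundedFormula.Realize φ _) (Subsingleton.elim _ _))
end

section
/- Let L be a first-order language containing a binary relation symbol <, let M be an L-structure in which < is interpreted as a dense linear order without endpoints, let U be a non-principal ultrafilter on an index set I, and let M* = M^(I)/U be the bounded ultrapower of M modulo U. Assume M satisfies condition (†): for every L-formula φ(x,ȳ) with parameters from M and all a,b ∈ M, if M ⊨ ∀ȳ ∈ (a,b) ∃x φ(x,ȳ), then there exist d,e ∈ M such that M ⊨ ∀ȳ ∈ (a,b) ∃x ∈ (d,e) φ(x,ȳ). Then M is an elementary substructure of M*, and M is cofinal and coinitial in M*. -/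
/-!
Statement 2: if `M` satisfies condition (†), then `M` is an elementary substructure of its
bounded ultrapower `M*`, and `M` is cofinal and coinitial in `M*`.
-/

open FirstOrder FirstOrder.Language FirstOrder.Language.Structure Filter

universe u v w x

/-- Condition (†): for every `L(M)`-formula `φ(x, ȳ)` (equivalently, every subset of
`M^(1+n)` definable with parameters from `M`, `x` being the first coordinate) and all
`a, b ∈ M`, if `M ⊨ ∀ ȳ ∈ (a,b) ∃ x φ(x, ȳ)` then there are `d, e ∈ M` with
`M ⊨ ∀ ȳ ∈ (a,b) ∃ x ∈ (d,e) φ(x, ȳ)`. -/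
def SatisfiesDagger (L : FirstOrder.Language.{u, v}) (M : Type w) [L.Structure M] [LT M] :
    Prop :=
  ∀ (n : ℕ) (Φ : Set (Fin (n + 1) → M)), (Set.univ : Set M).Definable L Φ →
    ∀ a b : M,
      (∀ y : Fin n → M, (∀ k, a < y k ∧ y k < b) → ∃ x : M, Fin.cons x y ∈ Φ) →
      ∃ d e : M, ∀ y : Fin n → M, (∀ k, a < y k ∧ y k < b) →
        ∃ x : M, (d < x ∧ x < e) ∧ Fin.cons x y ∈ Φ

/-- A finite family of bounded functions has a common strict lower and upper bound. -/
theorem exists_common_bounds {I : Type x} {M : Type w} [LinearOrder M] [Nonempty M]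
    {ι : Type*} [Finite ι] (f : ι → I → M) (hf : ∀ k, IsBoundedFun (f k)) :
    ∃ a b : M, ∀ k i, a < f k i ∧ f k i < b := by
  choose a b hab using hf
  obtain ⟨a', ha'⟩ := Finite.bddBelow_range a
  obtain ⟨b', hb'⟩ := Finite.bddAbove_range b
  exact ⟨a', b', fun k i => ⟨(ha' ⟨k, rfl⟩).trans_lt (hab k i).1,
    (hab k i).2.trans_le (hb' ⟨k, rfl⟩)⟩⟩

/-- Under (†), a formula in bounded functions has a bounded Skolem function. -/
theorem SatisfiesDagger.exists_bounded_witness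
    {L : FirstOrder.Language.{u, v}} {M : Type w} [L.Structure M] [LinearOrder M] [Nonempty M]
    (hdagger : SatisfiesDagger L M) {I : Type x} {m n : ℕ}
    (φ : L.BoundedFormula (Fin m) (n + 1)) (f : Fin m → I → M) (g : Fin n → I → M)
    (hf : ∀ k, IsBoundedFun (f k)) (hg : ∀ k, IsBoundedFun (g k)) :
    ∃ h : I → M, IsBoundedFun h ∧ ∀ i, (∃ c, φ.Realize (f · i) (Fin.snoc (g · i) c)) →
      φ.Realize (f · i) (Fin.snoc (g · i) (h i)) := by
  let old : Fin m ⊕ Fin n → Fin (m + n + 1) := fun s => (finSumFinEquiv s).succ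
  let all : Fin m ⊕ Fin (n + 1) → Fin (m + n + 1) :=
    Sum.elim (fun k => old (.inl k)) (Fin.snoc (fun k => old (.inr k)) 0)
  let A : Set (Fin m ⊕ Fin n → M) := {z | φ.ex.toFormula.Realize z}
  let B : Set (Fin m ⊕ Fin (n + 1) → M) := {z | φ.toFormula.Realize z}
  have hA : (Set.univ : Set M).Definable L A :=
    (Set.empty_definable_iff.2 ⟨_, rfl⟩).mono (Set.empty_subset _)
  have hB : (Set.univ : Set M).Definable L B :=
    (Set.empty_definable_iff.2 ⟨_, rfl⟩).mono (Set.empty_subset _)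
  have hΦ := (hA.preimage_comp old).compl.union (hB.preimage_comp all)
  have mem_Φ : ∀ (y : Fin (m + n) → M) (c : M),
      Fin.cons c y ∈ ((fun z : Fin (m + n + 1) → M => z ∘ old) ⁻¹' A)ᶜ ∪
        (fun z : Fin (m + n + 1) → M => z ∘ all) ⁻¹' B ↔
      ((∃ c', φ.Realize (fun k => y (finSumFinEquiv (.inl k)))
          (Fin.snoc (fun k => y (finSumFinEquiv (.inr k))) c')) →
        φ.Realize (fun k => y (finSumFinEquiv (.inl k)))
          (Fin.snoc (fun k => y (finSumFinEquiv (.inr k))) c)) := by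
    intro y c
    have hsnoc : ((Fin.cons c y : Fin (m + n + 1) → M) ∘ all) ∘ Sum.inr =
        (Fin.snoc (fun k => y (finSumFinEquiv (.inr k))) c : Fin (n + 1) → M) := by
      funext k
      refine Fin.lastCases ?_ (fun k => ?_) k <;> simp [all, old]
    simp only [Set.mem_union, Set.mem_compl_iff, Set.mem_preimage, A, B, Set.mem_ofPred_eq,
      BoundedFormula.realize_toFormula, BoundedFormula.realize_ex, hsnoc, ← imp_iff_not_or]
    rfl
  obtain ⟨a, b, hab⟩ := exists_common_bounds (Sum.elim f g) (by rintro (k | k) <;> simp [hf, hg])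
  obtain ⟨d, e, hde⟩ := hdagger _ _ hΦ a b fun y _ => by
    simp only [mem_Φ]
    by_cases h : ∃ c', φ.Realize (fun k => y (finSumFinEquiv (.inl k)))
          (Fin.snoc (fun k => y (finSumFinEquiv (.inr k))) c')
    · exact h.imp fun _ hc _ => hc
    · exact ⟨Classical.arbitrary M, fun h' => (h h').elim⟩
  have hwit := fun i => hde (fun k => Sum.elim f g (finSumFinEquiv.symm k) i) fun k => hab _ i
  simp only [mem_Φ, Equiv.symm_apply_apply, Sum.elim_inl, Sum.elim_inr] at hwit
  choose h hbd hh using hwit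
  exact ⟨h, ⟨d, e, hbd⟩, hh⟩

/-- **Łoś's theorem** for the bounded ultrapower of a structure satisfying (†). -/
theorem SatisfiesDagger.realize_boundedUltrapower
    {L : FirstOrder.Language.{u, v}} {M : Type w} [L.Structure M] [LinearOrder M] [Nonempty M]
    (hdagger : SatisfiesDagger L M) {I : Type x} (u : Ultrafilter I)
    (S : L.Substructure ((u : Filter I).Product fun _ : I => M))
    (hS : (S : Set ((u : Filter I).Product fun _ : I => M)) =
      {y | ∃ f : I → M, IsBoundedFun f ∧ (f : (u : Filter I).Product fun _ : I => M) = y})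
    {m n : ℕ} (φ : L.BoundedFormula (Fin m) n) (f : Fin m → I → M) (g : Fin n → I → M)
    (hf : ∀ k, IsBoundedFun (f k)) (hg : ∀ k, IsBoundedFun (g k))
    (p : Fin m → S) (q : Fin n → S)
    (hp : ∀ k, (p k : (u : Filter I).Product fun _ : I => M) = f k)
    (hq : ∀ k, (q k : (u : Filter I).Product fun _ : I => M) = g k) :
    φ.Realize p q ↔ ∀ᶠ i in u, φ.Realize (f · i) (g · i) := by
  have of_isQF : ∀ {n : ℕ} {ψ : L.BoundedFormula (Fin m) n}, ψ.IsQF →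
      ∀ (g : Fin n → I → M) (q : Fin n → S),
        (∀ k, (q k : (u : Filter I).Product fun _ : I => M) = g k) →
        (ψ.Realize p q ↔ ∀ᶠ i in u, ψ.Realize (f · i) (g · i)) := by
    intro n ψ hψ g q hq
    rw [← Ultraproduct.boundedFormula_realize_cast, ← hψ.realize_embedding S.subtype]
    have hp' : S.subtype ∘ p = fun k => (f k : (u : Filter I).Product fun _ : I => M) :=
      funext hp
    have hq' : S.subtype ∘ q = fun k => (g k : (u : Filter I).Product fun _ : I => M) :=
      funext hq
    rw [hp', hq']
    exact Iff.rfl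
  induction φ with
  | falsum => exact of_isQF BoundedFormula.isQF_bot g q hq
  | equal t₁ t₂ => exact of_isQF (BoundedFormula.IsAtomic.equal t₁ t₂).isQF g q hq
  | rel R ts => exact of_isQF (BoundedFormula.IsAtomic.rel R ts).isQF g q hq
  | imp _ _ ih₁ ih₂ =>
    simp only [BoundedFormula.realize_imp, ih₁ g hg q hq, ih₂ g hg q hq,
      Ultrafilter.eventually_imp]
  | @all n φ ih =>
    have step : ∀ (h : I → M) (r : S), IsBoundedFun h →
        (r : (u : Filter I).Product fun _ : I => M) = h →
        (φ.Realize p (Fin.snoc q r) ↔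
          ∀ᶠ i in u, φ.Realize (f · i) (Fin.snoc (g · i) (h i))) := by
      intro h r hh hr
      refine (ih (Fin.snoc g h : Fin (n + 1) → I → M)
        (Fin.lastCases (by simpa using hh) (by simpa using hg)) (Fin.snoc q r)
        (Fin.lastCases (by simpa using hr) (by simpa using hq))).trans ?_
      have hsnoc : ∀ i, (fun k => (Fin.snoc g h : Fin (n + 1) → I → M) k i) =
          (Fin.snoc (g · i) (h i) : Fin (n + 1) → M) := fun i =>
        funext (Fin.lastCases (by simp) (by simp))
      simp only [hsnoc]
    simp only [BoundedFormula.realize_all]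
    refine ⟨fun H => ?_, fun H r => ?_⟩
    · obtain ⟨h, hh, hwit⟩ := hdagger.exists_bounded_witness φ.not f g hf hg
      have hmem : (h : (u : Filter I).Product fun _ : I => M) ∈
          (S : Set ((u : Filter I).Product fun _ : I => M)) := hS ▸ ⟨h, hh, rfl⟩
      filter_upwards [(step h ⟨_, hmem⟩ hh rfl).1 (H _)] with i hi c
      by_contra hc
      exact hwit i ⟨c, hc⟩ hi
    · obtain ⟨h, hh, hr⟩ := hS.subset r.2
      exact (step h r hh hr.symm).2 (H.mono fun i hi => hi _)

/-- **Gaifman-style splitting for bounded ultrapowers.**  Here `L` has a designated binary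
relation symbol `lt` interpreted in `M` as a dense linear order `<` without endpoints, `u`
is a non-principal ultrafilter on `I`, the bounded ultrapower `M*` is realized as the
substructure `S` of the full ultrapower whose underlying set is exactly the set of classes
of bounded functions `I → M`, and `j : M → M*` sends `a` to the class of the constant
function with value `a`.  If `M` satisfies condition (†), then `j` is elementary (so `M` is
an elementary substructure of `M*`), and `M` is cofinal and coinitial in `M*`. -/
theorem bounded_ultrapower_elementary_of_dagger
    {L : FirstOrder.Language.{u, v}} {M : Type w} [L.Structure M]
    [LinearOrder M] [DenselyOrdered M] [NoMinOrder M] [NoMaxOrder M] [Nonempty M]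
    (lt : L.Relations 2)
    (hlt : ∀ a b : M, Structure.RelMap lt ![a, b] ↔ a < b)
    (hdagger : SatisfiesDagger L M)
    {I : Type x} (u : Ultrafilter I) (hu : ∀ i : I, (u : Filter I) ≠ pure i)
    (S : L.Substructure ((u : Filter I).Product fun _ : I => M))
    (hS : (S : Set ((u : Filter I).Product fun _ : I => M)) =
      {y | ∃ f : I → M, IsBoundedFun f ∧ (f : (u : Filter I).Product fun _ : I => M) = y})
    (j : M → S)
    (hj : ∀ a : M, (j a : (u : Filter I).Product fun _ : I => M) =
      ((fun _ : I => a) : (u : Filter I).Product fun _ : I => M)) :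
    (∀ {m : ℕ} (φ : L.Formula (Fin m)) (v : Fin m → M),
      (φ.Realize fun k => j (v k)) ↔ φ.Realize v) ∧
    (∀ x : S, ∃ a : M, Structure.RelMap lt ![j a, x] ∨ j a = x) ∧
    (∀ x : S, ∃ b : M, Structure.RelMap lt ![x, j b] ∨ x = j b) := by
  have hconst : ∀ a : M, IsBoundedFun fun _ : I => a := fun a =>
    ⟨(exists_lt a).choose, (exists_gt a).choose, fun _ =>
      ⟨(exists_lt a).choose_spec, (exists_gt a).choose_spec⟩⟩
  have relMap_lt : ∀ (p q : S) (f g : I → M),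
      (p : (u : Filter I).Product fun _ : I => M) = f →
      (q : (u : Filter I).Product fun _ : I => M) = g → (∀ i, f i < g i) →
      Structure.RelMap lt ![p, q] := by
    intro p q f g hp hq hfg
    have key := Ultraproduct.boundedFormula_realize_cast (u := u)
      (lt.boundedFormula₂ (Term.var (.inr 0)) (Term.var (.inr 1)) : L.BoundedFormula Empty 2)
      (fun _ _ => Classical.arbitrary M) ![f, g]
    simp only [BoundedFormula.realize_rel₂, Term.realize_var, Sum.elim_inr,
      Matrix.cons_val_zero, Matrix.cons_val_one, hlt] at key
    have hpq : S.subtype ∘ ![p, q] =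
        ![(f : (u : Filter I).Product fun _ : I => M),
          (g : (u : Filter I).Product fun _ : I => M)] := by
      funext k
      fin_cases k
      exacts [hp, hq]
    rw [← S.subtype.map_rel, hpq]
    exact key.2 (.of_forall hfg)
  refine ⟨fun {m} φ v => ?_, fun y => ?_, fun y => ?_⟩
  · have key := hdagger.realize_boundedUltrapower u S hS φ (fun k _ => v k) Fin.elim0
      (fun k => hconst _) (fun k => k.elim0) (fun k => j (v k)) default (fun k => hj _)
      (fun k => k.elim0)
    have hdefault : ∀ i : I, (fun k => (Fin.elim0 k : I → M) i) = (default : Fin 0 → M) :=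
      fun _ => Subsingleton.elim _ _
    simp only [hdefault, eventually_const] at key
    exact key
  · obtain ⟨f, ⟨a, b, hab⟩, hf⟩ := hS.subset y.2
    exact ⟨a, .inl (relMap_lt _ _ _ f (hj a) hf.symm fun i => (hab i).1)⟩
  · obtain ⟨f, ⟨a, b, hab⟩, hf⟩ := hS.subset y.2
    exact ⟨b, .inl (relMap_lt _ _ f _ hf.symm (hj b) fun i => (hab i).2)⟩
end

section
/- Let L be a first-order language containing a binary relation symbol <, let M be an L-structure in which < is interpreted as a dense linear order without endpoints, let U be a non-principal ultrafilter on an index set I, and let M^(I)⁺/U be the upper-bounded ultrapower of M modulo U. Assume M satisfies condition (†)⁺: for every L-formula φ(x,ȳ) with parameters from M and every a ∈ M, if M ⊨ ∀ȳ < a ∃x φ(x,ȳ), then there exists d ∈ M such that M ⊨ ∀ȳ < a ∃x < d φ(x,ȳ). Then M is an elementary substructure of M^(I)⁺/U. -/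
/-!
Statement 3: if `M` satisfies condition (†)⁺, then `M` is an elementary substructure of its
upper-bounded ultrapower `M^(I)⁺/U`.
-/

open FirstOrder FirstOrder.Language FirstOrder.Language.Structure Filter

universe u v w x

/-- A function `f : I → M` is upper bounded if there is `b ∈ M` with `f i < b` for all
`i ∈ I`. -/
def IsUpperBoundedFun {I : Type x} {M : Type w} [LT M] (f : I → M) : Prop :=
  ∃ b : M, ∀ i, f i < b

/-- Condition (†)⁺: for every `L(M)`-formula `φ(x, ȳ)` (equivalently, every subset of
`M^(1+n)` definable with parameters from `M`, `x` being the first coordinate) and every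
`a ∈ M`, if `M ⊨ ∀ ȳ < a ∃ x φ(x, ȳ)` then there is `d ∈ M` with
`M ⊨ ∀ ȳ < a ∃ x < d φ(x, ȳ)`. -/
def SatisfiesDaggerPlus (L : FirstOrder.Language.{u, v}) (M : Type w) [L.Structure M]
    [LT M] : Prop :=
  ∀ (n : ℕ) (Φ : Set (Fin (n + 1) → M)), (Set.univ : Set M).Definable L Φ →
    ∀ a : M,
      (∀ y : Fin n → M, (∀ k, y k < a) → ∃ x : M, Fin.cons x y ∈ Φ) →
      ∃ d : M, ∀ y : Fin n → M, (∀ k, y k < a) →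
        ∃ x : M, x < d ∧ Fin.cons x y ∈ Φ

/-- The solution set of a bounded formula, with its variables renamed along `e`, is definable. -/
theorem definable_setOf_realize_comp {L : FirstOrder.Language.{u, v}} {M : Type w}
    [L.Structure M] {α β : Type*} {n : ℕ} (A : Set M) (φ : L.BoundedFormula α n)
    (e : α ⊕ Fin n → β) :
    A.Definable L {y : β → M | φ.Realize (y ∘ e ∘ Sum.inl) (y ∘ e ∘ Sum.inr)} := by
  refine (Set.empty_definable_iff.2 ⟨φ.toFormula.relabel e, ?_⟩).mono (Set.empty_subset A)
  ext y
  exact (Formula.realize_relabel.trans (BoundedFormula.realize_toFormula φ (y ∘ e))).symm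

/-- Under (†)⁺, some `d` bounds counterexamples to `∀ x, φ(x)`, uniformly in the values below
`a` of the remaining variables. -/
theorem SatisfiesDaggerPlus.exists_forall_exists_lt_imp_forall {L : FirstOrder.Language.{u, v}}
    {M : Type w} [L.Structure M] [LT M] [Nonempty M] (h : SatisfiesDaggerPlus L M) {m n : ℕ}
    (φ : L.BoundedFormula (Fin m) (n + 1)) (a : M) :
    ∃ d : M, ∀ (y : Fin m → M) (z : Fin n → M), (∀ k, y k < a) → (∀ k, z k < a) →
      ∃ x < d, φ.Realize y (Fin.snoc z x) → ∀ x, φ.Realize y (Fin.snoc z x) := by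
  let e : Fin m ⊕ Fin n → Fin (m + n + 1) := fun k => (finSumFinEquiv k).succ
  let e' : Fin m ⊕ Fin (n + 1) → Fin (m + n + 1) :=
    Sum.elim (e ∘ Sum.inl) (Fin.snoc (α := fun _ => Fin (m + n + 1)) (e ∘ Sum.inr) 0)
  have hmem : ∀ (y : Fin m → M) (z : Fin n → M) (x : M),
      (Fin.cons x (Sum.elim y z ∘ finSumFinEquiv.symm) : Fin (m + n + 1) → M) ∈
        {w | φ.Realize (w ∘ e' ∘ Sum.inl) (w ∘ e' ∘ Sum.inr)}ᶜ ∪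
          {w | φ.all.Realize (w ∘ e ∘ Sum.inl) (w ∘ e ∘ Sum.inr)} ↔
      (φ.Realize y (Fin.snoc z x) → ∀ x, φ.Realize y (Fin.snoc z x)) := by
    intro y z x
    let w : Fin (m + n + 1) → M := Fin.cons x (Sum.elim y z ∘ finSumFinEquiv.symm)
    have hl : w ∘ e ∘ Sum.inl = y := by
      ext k
      simp [w, e, -finSumFinEquiv_apply_left]
    have hr : w ∘ e ∘ Sum.inr = z := by
      ext k
      simp [w, e, -finSumFinEquiv_apply_right]
    have hl' : w ∘ e' ∘ Sum.inl = y := hl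
    have hr' : w ∘ e' ∘ Sum.inr = (Fin.snoc z x : Fin (n + 1) → M) := by
      simp only [e', Sum.elim_comp_inr, Fin.comp_snoc, hr]
      rfl
    change ¬ φ.Realize (w ∘ e' ∘ Sum.inl) (w ∘ e' ∘ Sum.inr) ∨
      φ.all.Realize (w ∘ e ∘ Sum.inl) (w ∘ e ∘ Sum.inr) ↔ _
    rw [hl, hr, hl', hr', BoundedFormula.realize_all, imp_iff_not_or]
  obtain ⟨d, hd⟩ := h (m + n) _
    ((definable_setOf_realize_comp Set.univ φ e').compl.union
      (definable_setOf_realize_comp Set.univ φ.all e)) a fun y _ => by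
    obtain ⟨x, hx⟩ : ∃ x, φ.Realize (y ∘ finSumFinEquiv ∘ Sum.inl)
        (Fin.snoc (y ∘ finSumFinEquiv ∘ Sum.inr) x) →
        ∀ x, φ.Realize (y ∘ finSumFinEquiv ∘ Sum.inl)
          (Fin.snoc (y ∘ finSumFinEquiv ∘ Sum.inr) x) := by
      by_contra! hc
      obtain ⟨-, x, hx⟩ := hc (Classical.arbitrary M)
      exact hx (hc x).1
    refine ⟨x, ?_⟩
    have hy : Sum.elim (y ∘ finSumFinEquiv ∘ Sum.inl) (y ∘ finSumFinEquiv ∘ Sum.inr) ∘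
        finSumFinEquiv.symm = y := by
      ext k
      obtain ⟨k, rfl⟩ := finSumFinEquiv.surjective k
      rcases k with k | k <;>
        simp [-finSumFinEquiv_apply_left, -finSumFinEquiv_apply_right]
    rw [← hmem, hy] at hx
    exact hx
  refine ⟨d, fun y z hy hz => ?_⟩
  obtain ⟨x, hxd, hx⟩ := hd (Sum.elim y z ∘ finSumFinEquiv.symm) fun k => by
    obtain ⟨k, rfl⟩ := finSumFinEquiv.surjective k
    rcases k with k | k
    · simpa [-finSumFinEquiv_apply_left] using hy k
    · simpa [-finSumFinEquiv_apply_right] using hz k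
  exact ⟨x, hxd, (hmem y z x).1 hx⟩

/-- Finitely many upper-bounded functions have a common upper bound. -/
theorem exists_forall_lt_of_isUpperBoundedFun {I : Type x} {M : Type w} [LinearOrder M]
    [Nonempty M] {ι : Type*} [Finite ι] {f : ι → I → M} (hf : ∀ k, IsUpperBoundedFun (f k)) :
    ∃ a : M, ∀ k i, f k i < a := by
  choose b hb using hf
  obtain ⟨a, ha⟩ := Finite.exists_le b
  exact ⟨a, fun k i => (hb k i).trans_le (ha k)⟩

/-- **Łoś's theorem for upper-bounded ultrapowers**, given (†)⁺. -/
theorem SatisfiesDaggerPlus.realize_iff_eventually {L : FirstOrder.Language.{u, v}} {M : Type w}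
    [L.Structure M] [LinearOrder M] [Nonempty M] (h : SatisfiesDaggerPlus L M)
    {I : Type x} (U : Ultrafilter I)
    (S : L.Substructure ((U : Filter I).Product fun _ : I => M))
    (hS : (S : Set ((U : Filter I).Product fun _ : I => M)) =
      {y | ∃ f : I → M, IsUpperBoundedFun f ∧
        (f : (U : Filter I).Product fun _ : I => M) = y})
    {m n : ℕ} (φ : L.BoundedFormula (Fin m) n)
    (f : Fin m → I → M) (hf : ∀ k, IsUpperBoundedFun (f k))
    (g : Fin n → I → M) (hg : ∀ k, IsUpperBoundedFun (g k))
    (y : Fin m → S) (hy : ∀ k, (y k : (U : Filter I).Product fun _ : I => M) = (f k :))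
    (z : Fin n → S) (hz : ∀ k, (z k : (U : Filter I).Product fun _ : I => M) = (g k :)) :
    φ.Realize y z ↔ ∀ᶠ i in (U : Filter I), φ.Realize (fun k => f k i) (fun k => g k i) := by
  have hQF : ∀ {n : ℕ} {φ : L.BoundedFormula (Fin m) n}, φ.IsQF →
      ∀ (g : Fin n → I → M) (z : Fin n → S),
      (∀ k, (z k : (U : Filter I).Product fun _ : I => M) = (g k :)) →
      (φ.Realize y z ↔
        ∀ᶠ i in (U : Filter I), φ.Realize (fun k => f k i) (fun k => g k i)) := by
    intro n φ hφ g z hz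
    rw [← Ultraproduct.boundedFormula_realize_cast, ← hφ.realize_embedding S.subtype]
    exact iff_of_eq (congrArg₂ φ.Realize (funext hy) (funext hz))
  induction φ with
  | falsum => exact hQF BoundedFormula.IsQF.falsum g z hz
  | equal t₁ t₂ => exact hQF (BoundedFormula.IsAtomic.equal t₁ t₂).isQF g z hz
  | rel R ts => exact hQF (BoundedFormula.IsAtomic.rel R ts).isQF g z hz
  | imp _ _ ih₁ ih₂ =>
    simp only [BoundedFormula.realize_imp, ih₁ g hg z hz, ih₂ g hg z hz,
      Ultrafilter.eventually_imp]
  | @all n φ ih =>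
    have ih_snoc : ∀ p : I → M, IsUpperBoundedFun p → ∀ s : S,
        (s : (U : Filter I).Product fun _ : I => M) = (p :) →
        (φ.Realize y (Fin.snoc z s) ↔ ∀ᶠ i in (U : Filter I),
          φ.Realize (fun k => f k i) (Fin.snoc (fun k => g k i) (p i))) := by
      intro p hp s hs
      have hgp : ∀ k, IsUpperBoundedFun (Fin.snoc (α := fun _ => I → M) g p k) :=
        Fin.lastCases (by simpa using hp) (by simpa using hg)
      have hzs : ∀ k, ((Fin.snoc z s : Fin (n + 1) → S) k :
          (U : Filter I).Product fun _ : I => M) =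
          ((Fin.snoc (α := fun _ => I → M) g p k : I → M) :) :=
        Fin.lastCases (by simpa using hs) (by simpa using hz)
      refine (ih _ hgp _ hzs).trans ?_
      have hsnoc : ∀ i, (fun k => Fin.snoc (α := fun _ => I → M) g p k i) =
          Fin.snoc (α := fun _ => M) (fun k => g k i) (p i) := fun i => by
        ext k
        cases k using Fin.lastCases <;> simp
      simp only [hsnoc]
    simp only [BoundedFormula.realize_all]
    constructor
    · intro hall
      obtain ⟨a, ha⟩ := exists_forall_lt_of_isUpperBoundedFun hf
      obtain ⟨b, hb⟩ := exists_forall_lt_of_isUpperBoundedFun hg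
      obtain ⟨d, hd⟩ := h.exists_forall_exists_lt_imp_forall φ (max a b)
      choose p hpd hp using fun i => hd (fun k => f k i) (fun k => g k i)
        (fun k => lt_max_of_lt_left (ha k i)) (fun k => lt_max_of_lt_right (hb k i))
      have hpS := hS.superset ⟨p, ⟨d, hpd⟩, rfl⟩
      exact ((ih_snoc p ⟨d, hpd⟩ ⟨_, hpS⟩ rfl).1 (hall _)).mono hp
    · intro hall s
      obtain ⟨p, hp, hps⟩ := hS.subset s.2
      exact (ih_snoc p hp s hps.symm).2 (hall.mono fun i hi => hi (p i))

/-- **The upper-bounded ultrapower is an elementary extension, given (†)⁺.**  Here `L` has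
a designated binary relation symbol `lt` interpreted in `M` as a dense linear order `<`
without endpoints, `u` is a non-principal ultrafilter on `I`, the upper-bounded ultrapower
`M^(I)⁺/u` is realized as the substructure `S` of the full ultrapower whose underlying set
is exactly the set of classes of upper-bounded functions `I → M`, and `j : M → S` sends
`a` to the class of the constant function with value `a`.  If `M` satisfies condition
(†)⁺, then `j` is elementary, i.e. `M` is an elementary substructure of `M^(I)⁺/u`. -/
theorem upper_bounded_ultrapower_elementary_of_dagger_plus
    {L : FirstOrder.Language.{u, v}} {M : Type w} [L.Structure M]
    [LinearOrder M] [DenselyOrdered M] [NoMinOrder M] [NoMaxOrder M] [Nonempty M]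
    (lt : L.Relations 2)
    (hlt : ∀ a b : M, Structure.RelMap lt ![a, b] ↔ a < b)
    (hdagger : SatisfiesDaggerPlus L M)
    {I : Type x} (u : Ultrafilter I) (hu : ∀ i : I, (u : Filter I) ≠ pure i)
    (S : L.Substructure ((u : Filter I).Product fun _ : I => M))
    (hS : (S : Set ((u : Filter I).Product fun _ : I => M)) =
      {y | ∃ f : I → M, IsUpperBoundedFun f ∧
        (f : (u : Filter I).Product fun _ : I => M) = y})
    (j : M → S)
    (hj : ∀ a : M, (j a : (u : Filter I).Product fun _ : I => M) =
      ((fun _ : I => a) : (u : Filter I).Product fun _ : I => M)) :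
    ∀ {m : ℕ} (φ : L.Formula (Fin m)) (v : Fin m → M),
      (φ.Realize fun k => j (v k)) ↔ φ.Realize v := by
  intro m φ v
  have hbdd : ∀ a : M, IsUpperBoundedFun fun _ : I => a := fun a =>
    (exists_gt a).imp fun _ hb _ => hb
  exact (hdagger.realize_iff_eventually u S hS φ (fun k _ => v k) (fun k => hbdd (v k))
    (fun k => k.elim0) (fun k => k.elim0) (fun k => j (v k)) (fun k => hj (v k)) default
    (fun k => k.elim0)).trans <| by
      simp only [Formula.Realize, Subsingleton.elim (fun k : Fin 0 => _) default,
        Filter.eventually_const]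
end

section
/- Let L be a first-order language containing a binary relation symbol <, let M be an L-structure in which < is interpreted as a dense linear order without endpoints, let U be a non-principal ultrafilter on an index set I, and let M^(I)⁻/U be the lower-bounded ultrapower of M modulo U. Assume M satisfies condition (†)⁻: for every L-formula φ(x,ȳ) with parameters from M and every a ∈ M, if M ⊨ ∀ȳ > a ∃x φ(x,ȳ), then there exists d ∈ M such that M ⊨ ∀ȳ > a ∃x > d φ(x,ȳ). Then M is an elementary substructure of M^(I)⁻/U. -/
/-!
Statement 4: if `M` satisfies condition (†)⁻, then `M` is an elementary substructure of its
lower-bounded ultrapower `M^(I)⁻/U`.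
-/

open FirstOrder FirstOrder.Language FirstOrder.Language.Structure Filter

universe u v w x

/-- A function `f : I → M` is lower bounded if there is `a ∈ M` with `a < f i` for all
`i ∈ I`. -/
def IsLowerBoundedFun {I : Type x} {M : Type w} [LT M] (f : I → M) : Prop :=
  ∃ a : M, ∀ i, a < f i

/-- Condition (†)⁻: for every `L(M)`-formula `φ(x, ȳ)` (equivalently, every subset of
`M^(1+n)` definable with parameters from `M`, `x` being the first coordinate) and every
`a ∈ M`, if `M ⊨ ∀ ȳ > a ∃ x φ(x, ȳ)` then there is `d ∈ M` with
`M ⊨ ∀ ȳ > a ∃ x > d φ(x, ȳ)`. -/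
def SatisfiesDaggerMinus (L : FirstOrder.Language.{u, v}) (M : Type w) [L.Structure M]
    [LT M] : Prop :=
  ∀ (n : ℕ) (Φ : Set (Fin (n + 1) → M)), (Set.univ : Set M).Definable L Φ →
    ∀ a : M,
      (∀ y : Fin n → M, (∀ k, a < y k) → ∃ x : M, Fin.cons x y ∈ Φ) →
      ∃ d : M, ∀ y : Fin n → M, (∀ k, a < y k) →
        ∃ x : M, d < x ∧ Fin.cons x y ∈ Φ

/-- The set of tuples realizing a bounded formula without free variables is definable. -/
theorem FirstOrder.Language.BoundedFormula.definable_realize {L : FirstOrder.Language.{u, v}}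
    {M : Type w} [L.Structure M] {n : ℕ} (A : Set M) (φ : L.BoundedFormula Empty n) :
    A.Definable L {z : Fin n → M | φ.Realize default z} := by
  refine Set.Definable.mono (A := ∅) ?_ (Set.empty_subset A)
  refine Set.empty_definable_iff.2 ⟨φ.toFormula.relabel (Sum.elim Empty.elim id), ?_⟩
  ext z
  simp only [Set.mem_ofPred_eq, Formula.realize_relabel, BoundedFormula.realize_toFormula]
  exact iff_of_eq (congrArg₂ φ.Realize (Subsingleton.elim _ _) rfl)

/-- Under (†)⁻, solutions of a formula with parameters above `a` can be chosen above a fixed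
bound `d` whenever they exist. -/
theorem SatisfiesDaggerMinus.exists_bound {L : FirstOrder.Language.{u, v}} {M : Type w}
    [L.Structure M] [LT M] [Nonempty M] (h : SatisfiesDaggerMinus L M) {n : ℕ}
    (φ : L.BoundedFormula Empty (n + 1)) (a : M) :
    ∃ d : M, ∀ y : Fin n → M, (∀ k, a < y k) →
      ∃ x : M, d < x ∧
        ((∃ x' : M, φ.Realize default (Fin.snoc y x' : Fin (n + 1) → M)) →
          φ.Realize default (Fin.snoc y x : Fin (n + 1) → M)) := by
  let σ : Fin (n + 1) → Fin (n + 1) := Fin.snoc (α := fun _ => Fin (n + 1)) Fin.succ 0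
  have cons_comp_σ (x : M) (y : Fin n → M) :
      (Fin.cons x y : Fin (n + 1) → M) ∘ σ = (Fin.snoc y x : Fin (n + 1) → M) := by
    funext k
    refine Fin.lastCases ?_ (fun k => ?_) k <;> simp [σ]
  have cons_comp_succ (x : M) (y : Fin n → M) :
      (Fin.cons x y : Fin (n + 1) → M) ∘ Fin.succ = y := by
    funext k
    simp
  let Φ : Set (Fin (n + 1) → M) :=
    (fun g => g ∘ Fin.succ) ⁻¹' {z | φ.ex.Realize default z}ᶜ ∪
      (fun g => g ∘ σ) ⁻¹' {z | φ.Realize default z}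
  have mem_Φ (x : M) (y : Fin n → M) : Fin.cons x y ∈ Φ ↔
      ((∃ x' : M, φ.Realize default (Fin.snoc y x' : Fin (n + 1) → M)) →
        φ.Realize default (Fin.snoc y x : Fin (n + 1) → M)) := by
    simp only [Φ, Set.mem_union, Set.mem_preimage, Set.mem_compl_iff, Set.mem_ofPred_eq,
      cons_comp_σ, cons_comp_succ, BoundedFormula.realize_ex, imp_iff_not_or]
  have hΦ : (Set.univ : Set M).Definable L Φ :=
    ((φ.ex.definable_realize _).compl.preimage_comp _).union
      ((φ.definable_realize _).preimage_comp _)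
  obtain ⟨d, hd⟩ := h n Φ hΦ a fun y _ => by
    by_cases hy : ∃ x' : M, φ.Realize default (Fin.snoc y x' : Fin (n + 1) → M)
    · exact hy.imp fun x hx => (mem_Φ x y).2 fun _ => hx
    · exact ⟨Classical.arbitrary M, (mem_Φ _ y).2 fun h => absurd h hy⟩
  exact ⟨d, fun y hy => (hd y hy).imp fun x hx => ⟨hx.1, (mem_Φ x y).1 hx.2⟩⟩

/-- Finitely many lower-bounded functions have a common strict lower bound. -/
theorem exists_forall_lt_of_isLowerBoundedFun {ι : Type*} [Finite ι] {I : Type x} {M : Type w}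
    [LinearOrder M] [Nonempty M] {f : ι → I → M} (hf : ∀ k, IsLowerBoundedFun (f k)) :
    ∃ a : M, ∀ k i, a < f k i := by
  choose b hb using hf
  obtain ⟨a, ha⟩ := (Set.finite_range b).bddBelow
  exact ⟨a, fun k i => (ha ⟨k, rfl⟩).trans_lt (hb k i)⟩

/-- Under (†)⁻, the lower-bounded ultrapower is an elementary substructure of the full
ultrapower. -/
theorem SatisfiesDaggerMinus.isElementary_lowerBounded {L : FirstOrder.Language.{u, v}}
    {M : Type w} [L.Structure M] [LinearOrder M] [Nonempty M] (h : SatisfiesDaggerMinus L M)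
    {I : Type x} (u : Ultrafilter I)
    (S : L.Substructure ((u : Filter I).Product fun _ : I => M))
    (hS : (S : Set ((u : Filter I).Product fun _ : I => M)) =
      {y | ∃ f : I → M, IsLowerBoundedFun f ∧
        (f : (u : Filter I).Product fun _ : I => M) = y}) :
    S.IsElementary := by
  let mk : (I → M) → (u : Filter I).Product fun _ : I => M := fun f => f
  have los {n : ℕ} (φ : L.BoundedFormula Empty (n + 1)) (f : Fin n → I → M) (g : I → M) :
      φ.Realize default (Fin.snoc (mk ∘ f) (mk g) : Fin (n + 1) → _) ↔
        ∀ᶠ i in u, φ.Realize default (Fin.snoc (fun k => f k i) (g i) : Fin (n + 1) → M) := by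
    have key := Ultraproduct.boundedFormula_realize_cast (u := u) φ
      (fun e : Empty => e.elim) (Fin.snoc f g : Fin (n + 1) → I → M)
    have eval_snoc (i : I) : (Fin.snoc (fun k => f k i) (g i) : Fin (n + 1) → M) =
        fun k => (Fin.snoc f g : Fin (n + 1) → I → M) k i :=
      (Fin.comp_snoc (fun p : I → M => p i) f g).symm
    refine (iff_of_eq ?_).trans (key.trans (eventually_congr (.of_forall fun i => ?_)))
    · exact congrArg₂ φ.Realize (Subsingleton.elim _ _) (Fin.comp_snoc mk f g).symm
    · rw [eval_snoc]
      exact iff_of_eq (congrArg (φ.Realize · _) (Subsingleton.elim _ _))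
  refine S.isElementary_of_exists fun n φ x c hc => ?_
  have hx (k : Fin n) : ∃ f : I → M, IsLowerBoundedFun f ∧ mk f = x k := by
    have hk : (x k : (u : Filter I).Product fun _ : I => M) ∈
      (S : Set ((u : Filter I).Product fun _ : I => M)) := (x k).2
    rwa [hS] at hk
  choose f hf hfx using hx
  obtain ⟨g, rfl⟩ : ∃ g, mk g = c := Quotient.exists_rep c
  obtain ⟨a, ha⟩ := exists_forall_lt_of_isLowerBoundedFun hf
  obtain ⟨d, hd⟩ := h.exists_bound φ a
  choose p hdp hp using fun i => hd (fun k => f k i) fun k => ha k i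
  have hpS : mk p ∈ S := by
    rw [← SetLike.mem_coe, hS]
    exact ⟨p, ⟨d, hdp⟩, rfl⟩
  have hxf : ((↑) ∘ x : Fin n → (u : Filter I).Product fun _ : I => M) = mk ∘ f :=
    funext fun k => (hfx k).symm
  rw [hxf] at hc ⊢
  exact ⟨⟨mk p, hpS⟩, (los φ f p).2 (((los φ f g).1 hc).mono fun i hi => hp i ⟨g i, hi⟩)⟩

/-- **The lower-bounded ultrapower is an elementary extension, given (†)⁻.**  Here `L` has
a designated binary relation symbol `lt` interpreted in `M` as a dense linear order `<`
without endpoints, `u` is a non-principal ultrafilter on `I`, the lower-bounded ultrapower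
`M^(I)⁻/u` is realized as the substructure `S` of the full ultrapower whose underlying set
is exactly the set of classes of lower-bounded functions `I → M`, and `j : M → S` sends
`a` to the class of the constant function with value `a`.  If `M` satisfies condition
(†)⁻, then `j` is elementary, i.e. `M` is an elementary substructure of `M^(I)⁻/u`. -/
theorem lower_bounded_ultrapower_elementary_of_dagger_minus
    {L : FirstOrder.Language.{u, v}} {M : Type w} [L.Structure M]
    [LinearOrder M] [DenselyOrdered M] [NoMinOrder M] [NoMaxOrder M] [Nonempty M]
    (lt : L.Relations 2)
    (hlt : ∀ a b : M, Structure.RelMap lt ![a, b] ↔ a < b)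
    (hdagger : SatisfiesDaggerMinus L M)
    {I : Type x} (u : Ultrafilter I) (hu : ∀ i : I, (u : Filter I) ≠ pure i)
    (S : L.Substructure ((u : Filter I).Product fun _ : I => M))
    (hS : (S : Set ((u : Filter I).Product fun _ : I => M)) =
      {y | ∃ f : I → M, IsLowerBoundedFun f ∧
        (f : (u : Filter I).Product fun _ : I => M) = y})
    (j : M → S)
    (hj : ∀ a : M, (j a : (u : Filter I).Product fun _ : I => M) =
      ((fun _ : I => a) : (u : Filter I).Product fun _ : I => M)) :
    ∀ {m : ℕ} (φ : L.Formula (Fin m)) (v : Fin m → M),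
      (φ.Realize fun k => j (v k)) ↔ φ.Realize v := by
  intro m φ v
  rw [← hdagger.isElementary_lowerBounded u S hS φ]
  have hjv : ((↑) ∘ fun k => j (v k) : Fin m → (u : Filter I).Product fun _ : I => M) =
      fun k => ((fun _ : I => v k) : (u : Filter I).Product fun _ : I => M) :=
    funext fun k => hj (v k)
  rw [hjv]
  exact (Ultraproduct.realize_formula_cast φ fun k _ => v k).trans eventually_const
end

section
/- Let M = (M,<,…) be an almost o-minimal structure that is not o-minimal, and suppose M is downward o-minimal. Let N be an elementary extension of M in which M is cofinal. Then N is downward o-minimal. -/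
open FirstOrder FirstOrder.Language

universe u v w x

/-- A subset of a linear order is an open interval (possibly unbounded). -/
def IsOpenIntervalSet {M : Type w} [LinearOrder M] (s : Set M) : Prop :=
  (∃ a b : M, s = Set.Ioo a b) ∨ (∃ a : M, s = Set.Ioi a) ∨ (∃ b : M, s = Set.Iio b) ∨
    s = Set.univ

/-- `s` is a finite union of points and open intervals. -/
def IsFinUnionPointsIntervals {M : Type w} [LinearOrder M] (s : Set M) : Prop :=
  ∃ (F : Finset M) (n : ℕ) (J : Fin n → Set M),
    (∀ k, IsOpenIntervalSet (J k)) ∧ s = ↑F ∪ ⋃ k, J k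

/-- `M` is o-minimal: every subset of `M` definable with parameters is a finite union of
points and open intervals. -/
def IsOMinimal (L : FirstOrder.Language.{u, v}) (M : Type w) [L.Structure M]
    [LinearOrder M] : Prop :=
  ∀ s : Set M, (Set.univ : Set M).Definable₁ L s → IsFinUnionPointsIntervals s

/-- `M` is almost o-minimal: every bounded definable (with parameters) subset of `M` is a
finite union of points and open intervals. -/
def IsAlmostOMinimal (L : FirstOrder.Language.{u, v}) (M : Type w) [L.Structure M]
    [LinearOrder M] : Prop :=
  ∀ s : Set M, (Set.univ : Set M).Definable₁ L s → BddAbove s → BddBelow s →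
    IsFinUnionPointsIntervals s

/-- `M` is downward o-minimal: every definable (with parameters) subset of `M` that is
bounded above is a finite union of points and open intervals. -/
def IsDownwardOMinimal (L : FirstOrder.Language.{u, v}) (M : Type w) [L.Structure M]
    [LinearOrder M] : Prop :=
  ∀ s : Set M, (Set.univ : Set M).Definable₁ L s → BddAbove s → IsFinUnionPointsIntervals s

/-- `M` is upward o-minimal: every definable (with parameters) subset of `M` that is
bounded below is a finite union of points and open intervals. -/
def IsUpwardOMinimal (L : FirstOrder.Language.{u, v}) (M : Type w) [L.Structure M]
    [LinearOrder M] : Prop :=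
  ∀ s : Set M, (Set.univ : Set M).Definable₁ L s → BddBelow s → IsFinUnionPointsIntervals s

/-- Two points lie in the same cell of the decomposition of the line given by `F`. -/
def SameCut {I : Type*} [LinearOrder I] (F : Set I) (x y : I) : Prop :=
  ∀ p ∈ F, (x < p ↔ y < p) ∧ (p < x ↔ p < y)

/-- A coordinate function or a constant function on `Δ → I`. -/
def IsCoord {I : Type w} {Δ : Type} (e : (Δ → I) → I) : Prop :=
  (∃ i, e = fun v => v i) ∨ ∃ c, e = fun _ => c

/-- An o-minimal system of definable predicates (with parameters) on powers of `I`. -/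
class OMinSys (I : Type w) [LinearOrder I] where
  Dfn : ∀ {Δ : Type}, ((Δ → I) → Prop) → Prop
  not : ∀ {Δ : Type} {P : (Δ → I) → Prop}, Dfn P → Dfn fun v => ¬ P v
  and : ∀ {Δ : Type} {P Q : (Δ → I) → Prop}, Dfn P → Dfn Q → Dfn fun v => P v ∧ Q v
  ex : ∀ {Δ : Type} {P : (Option Δ → I) → Prop}, Dfn P →
    Dfn fun v : Δ → I => ∃ x, P fun o => o.elim x v
  subst : ∀ {Γ Δ : Type} {P : (Γ → I) → Prop} {e : (Δ → I) → Γ → I}, Dfn P →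
    (∀ γ, IsCoord fun v => e v γ) → Dfn fun v => P (e v)
  lt : Dfn fun v : Bool → I => v false < v true
  tame : ∀ {P : (Unit → I) → Prop}, Dfn P →
    ∃ F : Finset I, ∀ x y, SameCut (F : Set I) x y → (P (fun _ => x) ↔ P fun _ => y)

/-- A type `Y` together with the maps `(Δ → I) → Y` regarded as definable. -/
class Plots (I : Type w) (Y : Type x) where
  IsPlot : ∀ {Δ : Type}, ((Δ → I) → Y) → Prop
  reindex : ∀ {Δ Δ' : Type} {e : (Δ → I) → Y} (σ : Δ → Δ'), IsPlot e →
    IsPlot fun v : Δ' → I => e fun d => v (σ d)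

instance Plots.self (I : Type w) : Plots I I where
  IsPlot := IsCoord
  reindex := by
    rintro Δ Δ' e σ (⟨i, rfl⟩ | ⟨c, rfl⟩)
    · exact Or.inl ⟨σ i, rfl⟩
    · exact Or.inr ⟨c, rfl⟩

instance Plots.prod (I : Type w) (Y : Type*) (Z : Type*) [Plots I Y] [Plots I Z] :
    Plots I (Y × Z) where
  IsPlot e := Plots.IsPlot (fun v => (e v).1) ∧ Plots.IsPlot (fun v => (e v).2)
  reindex σ h := ⟨Plots.reindex σ h.1, Plots.reindex σ h.2⟩

instance Plots.pi (I : Type w) (n : ℕ) : Plots I (Fin n → I) where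
  IsPlot e := ∀ i, IsCoord fun v => e v i
  reindex σ h i := (Plots.self I).reindex σ (h i)

instance Plots.prop (I : Type w) [LinearOrder I] [OMinSys I] : Plots I Prop where
  IsPlot e := OMinSys.Dfn e
  reindex σ h := OMinSys.subst h fun γ => Or.inl ⟨σ γ, rfl⟩

/-- Maps carrying plots to plots. A predicate is definable if it is such a map into `Prop`. -/
@[fun_prop]
def DMap (I : Type w) {Y : Type*} {Z : Type*} [Plots I Y] [Plots I Z] (f : Y → Z) : Prop :=
  ∀ (Δ : Type) (e : (Δ → I) → Y), Plots.IsPlot e → Plots.IsPlot fun v => f (e v)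

namespace DMap

section maps

variable {I : Type w} {X Y Z : Type*} [Plots I X] [Plots I Y] [Plots I Z]

@[fun_prop]
theorem id' : DMap I fun y : Y => y := fun _ _ h => h

@[fun_prop]
theorem comp' {f : Y → Z} {g : X → Y} (hf : DMap I f) (hg : DMap I g) :
    DMap I fun x => f (g x) := fun Δ e h => hf _ _ (hg Δ e h)

@[fun_prop]
theorem fst' {f : X → Y × Z} (hf : DMap I f) : DMap I fun x => (f x).1 :=
  fun Δ e h => (hf Δ e h).1

@[fun_prop]
theorem snd' {f : X → Y × Z} (hf : DMap I f) : DMap I fun x => (f x).2 :=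
  fun Δ e h => (hf Δ e h).2

@[fun_prop]
theorem prodMk {f : X → Y} {g : X → Z} (hf : DMap I f) (hg : DMap I g) :
    DMap I fun x => (f x, g x) := fun Δ e h => ⟨hf Δ e h, hg Δ e h⟩

@[fun_prop]
theorem const' (c : I) : DMap I fun _ : X => c := fun _ _ _ => Or.inr ⟨c, rfl⟩

@[fun_prop]
theorem constTuple {n : ℕ} (c : Fin n → I) : DMap I fun _ : X => c :=
  fun _ _ _ i => Or.inr ⟨c i, rfl⟩

@[fun_prop]
theorem cons {n : ℕ} {f : X → I} {g : X → Fin n → I} (hf : DMap I f) (hg : DMap I g) :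
    DMap I fun x => Matrix.vecCons (f x) (g x) := by
  intro Δ e h i
  refine Fin.cases ?_ (fun i => ?_) i
  · exact hf Δ e h
  · exact hg Δ e h i

@[fun_prop]
theorem head {n : ℕ} {g : X → Fin (n + 1) → I} (hg : DMap I g) :
    DMap I fun x => Matrix.vecHead (g x) := fun Δ e h => hg Δ e h 0

@[fun_prop]
theorem tail {n : ℕ} {g : X → Fin (n + 1) → I} (hg : DMap I g) :
    DMap I fun x => Matrix.vecTail (g x) := fun Δ e h i => hg Δ e h i.succ

end maps

section props

variable {I : Type w} [LinearOrder I] [OMinSys I] {X Y : Type*} [Plots I X] [Plots I Y]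

@[fun_prop]
theorem not {P : X → Prop} (hP : DMap I P) : DMap I fun x => ¬ P x :=
  fun Δ e h => OMinSys.not (hP Δ e h)

@[fun_prop]
theorem and {P Q : X → Prop} (hP : DMap I P) (hQ : DMap I Q) : DMap I fun x => P x ∧ Q x :=
  fun Δ e h => OMinSys.and (hP Δ e h) (hQ Δ e h)

@[fun_prop]
theorem or {P Q : X → Prop} (hP : DMap I P) (hQ : DMap I Q) : DMap I fun x => P x ∨ Q x := by
  have := (hP.not.and hQ.not).not
  simpa only [not_and_or, not_not] using this

@[fun_prop]
theorem imp {P Q : X → Prop} (hP : DMap I P) (hQ : DMap I Q) : DMap I fun x => P x → Q x := by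
  simpa only [imp_iff_not_or] using hP.not.or hQ

@[fun_prop]
theorem iff {P Q : X → Prop} (hP : DMap I P) (hQ : DMap I Q) : DMap I fun x => (P x ↔ Q x) := by
  simpa only [iff_iff_implies_and_implies] using (hP.imp hQ).and (hQ.imp hP)

@[fun_prop]
theorem lt {f g : X → I} (hf : DMap I f) (hg : DMap I g) : DMap I fun x => f x < g x := by
  intro Δ e h
  exact OMinSys.subst (e := fun v b => bif b then g (e v) else f (e v)) OMinSys.lt
    (by rintro (_ | _); exacts [hf Δ e h, hg Δ e h])

@[fun_prop]
theorem le {f g : X → I} (hf : DMap I f) (hg : DMap I g) : DMap I fun x => f x ≤ g x := by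
  simpa only [not_lt] using (hg.lt hf).not

@[fun_prop]
theorem eq {f g : X → I} (hf : DMap I f) (hg : DMap I g) : DMap I fun x => f x = g x := by
  simpa only [le_antisymm_iff] using (hf.le hg).and (hg.le hf)

@[fun_prop]
theorem ex {P : X → I → Prop} (hP : DMap I fun p : X × I => P p.1 p.2) :
    DMap I fun x => ∃ y, P x y := by
  intro Δ e h
  exact OMinSys.ex (hP _ (fun w : Option Δ → I => (e fun d => w (some d), w none))
    ⟨Plots.reindex some h, Or.inl ⟨none, rfl⟩⟩)

@[fun_prop]
theorem all {P : X → I → Prop} (hP : DMap I fun p : X × I => P p.1 p.2) :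
    DMap I fun x => ∀ y, P x y := by
  have := (ex (P := fun x y => ¬ P x y) hP.not).not
  simpa only [not_exists_not] using this

end props

end DMap

section line

variable {I : Type w} [LinearOrder I]

instance OMinSys.dual [OMinSys I] : OMinSys Iᵒᵈ where
  Dfn := OMinSys.Dfn (I := I)
  not := OMinSys.not (I := I)
  and := OMinSys.and (I := I)
  ex := OMinSys.ex (I := I)
  subst := OMinSys.subst (I := I)
  lt := OMinSys.subst (I := I) (e := fun v b => v (!b)) OMinSys.lt
    fun b => Or.inl ⟨!b, rfl⟩
  tame h := by
    obtain ⟨F, hF⟩ := OMinSys.tame (I := I) h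
    exact ⟨F, fun x y hxy => hF x y fun p hp => (hxy p hp).symm⟩

theorem DMap.tame [OMinSys I] {S : I → Prop} (hS : DMap I S) :
    ∃ F : Finset I, ∀ x y, SameCut (F : Set I) x y → (S x ↔ S y) :=
  OMinSys.tame (hS Unit (fun v => v ()) (Or.inl ⟨(), rfl⟩))

theorem Finset.exists_gap_right (F : Finset I) {a b : I} (hab : a < b) :
    ∃ q, a < q ∧ q ≤ b ∧ ∀ p ∈ F, a < p → q ≤ p := by
  classical
  induction F using Finset.induction_on with
  | empty => exact ⟨b, hab, le_rfl, by simp⟩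
  | insert c F _ ih =>
    obtain ⟨q, haq, hqb, hq⟩ := ih
    by_cases hc : a < c
    · refine ⟨min q c, lt_min haq hc, (min_le_left _ _).trans hqb, ?_⟩
      intro p hp hap
      rcases Finset.mem_insert.1 hp with rfl | hp
      · exact min_le_right _ _
      · exact (min_le_left _ _).trans (hq p hp hap)
    · refine ⟨q, haq, hqb, ?_⟩
      intro p hp hap
      rcases Finset.mem_insert.1 hp with rfl | hp
      · exact absurd hap hc
      · exact hq p hp hap

theorem Finset.exists_gap_left (F : Finset I) {a b : I} (hab : a < b) :
    ∃ q, a ≤ q ∧ q < b ∧ ∀ p ∈ F, p < b → p ≤ q := by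
  obtain ⟨q, h1, h2, h3⟩ := Finset.exists_gap_right (I := Iᵒᵈ) F (a := b) (b := a) hab
  exact ⟨q, h2, h1, h3⟩

theorem sameCut_of_gap {F : Set I} {a b x y : I} (hF : ∀ p ∈ F, a < p → b ≤ p)
    (hax : a < x) (hxb : x < b) (hay : a < y) (hyb : y < b) : SameCut F x y := by
  intro p hp
  rcases le_or_gt p a with h | h
  · exact ⟨iff_of_false (h.trans_lt hax).not_gt (h.trans_lt hay).not_gt,
      iff_of_true (h.trans_lt hax) (h.trans_lt hay)⟩
  · have h' := hF p hp h
    exact ⟨iff_of_true (hxb.trans_le h') (hyb.trans_le h'),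
      iff_of_false (hxb.trans_le h').not_gt (hyb.trans_le h').not_gt⟩

variable [OMinSys I] {S : I → Prop}

theorem DMap.germ_right (hS : DMap I S) {a b : I} (hab : a < b) :
    ∃ q, a < q ∧ q ≤ b ∧
      ((∀ x, a < x → x < q → S x) ∨ (∀ x, a < x → x < q → ¬ S x)) := by
  obtain ⟨F, hF⟩ := hS.tame
  obtain ⟨q, haq, hqb, hq⟩ := F.exists_gap_right hab
  refine ⟨q, haq, hqb, ?_⟩
  by_cases h : ∃ x, a < x ∧ x < q ∧ S x
  · obtain ⟨x, hax, hxq, hx⟩ := h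
    exact Or.inl fun y hay hyq => (hF x y (sameCut_of_gap hq hax hxq hay hyq)).1 hx
  · exact Or.inr fun y hay hyq hy => h ⟨y, hay, hyq, hy⟩

theorem DMap.germ_left (hS : DMap I S) {a b : I} (hab : a < b) :
    ∃ q, a ≤ q ∧ q < b ∧
      ((∀ x, q < x → x < b → S x) ∨ (∀ x, q < x → x < b → ¬ S x)) := by
  have hS' : DMap Iᵒᵈ fun x : Iᵒᵈ => S (OrderDual.ofDual x) := hS
  obtain ⟨q, h1, h2, h3⟩ := hS'.germ_right (OrderDual.toDual_lt_toDual.2 hab)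
  exact ⟨q, h2, h1, h3.imp (fun h x h1 h2 => h x h2 h1) (fun h x h1 h2 => h x h2 h1)⟩

theorem DMap.exists_isLUB [DenselyOrdered I] (hS : DMap I S) (hne : ∃ x, S x)
    (hbdd : ∃ b, ∀ x, S x → x ≤ b) : ∃ s, IsLUB {x | S x} s := by
  classical
  obtain ⟨x₀, hx₀⟩ := hne
  obtain ⟨b, hb⟩ := hbdd
  by_contra! hno
  have hD : DMap I fun x => ∃ y, S y ∧ x ≤ y := by fun_prop
  obtain ⟨F, hF⟩ := hD.tame
  have key : ∀ G : Finset I, ∃ d u, (∃ y, S y ∧ d ≤ y) ∧ (¬ ∃ y, S y ∧ u ≤ y) ∧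
      ∀ p ∈ G, p < d ∨ u < p := by
    intro G
    induction G using Finset.induction_on with
    | empty =>
      by_cases hSb : S b
      · exact (hno b ⟨fun x hx => hb x hx, fun u hu => hu hSb⟩).elim
      · exact ⟨x₀, b, ⟨x₀, hx₀, le_rfl⟩,
          fun ⟨y, hy, hby⟩ => hSb ((hb y hy).antisymm hby ▸ hy), by simp⟩
    | insert c G _ ih =>
      obtain ⟨d, u, ⟨y, hy, hdy⟩, hu, hG⟩ := ih
      by_cases hc : ∃ y, S y ∧ c < y
      · obtain ⟨z, hz, hcz⟩ := hc
        refine ⟨max d z, u, ?_, hu, ?_⟩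
        · rcases le_total d z with h | h
          · exact ⟨z, hz, by simp [h]⟩
          · exact ⟨y, hy, by simp [h, hdy]⟩
        · intro p hp
          rcases Finset.mem_insert.1 hp with rfl | hp
          · exact Or.inl (lt_max_of_lt_right hcz)
          · exact (hG p hp).imp lt_max_of_lt_left id
      · push Not at hc
        have : ∃ u', u' < c ∧ ∀ y, S y → y < u' := by
          by_contra! h
          refine hno c ⟨fun x hx => hc x hx, fun t ht => ?_⟩
          by_contra! htc
          obtain ⟨t', htt', ht'c⟩ := exists_between htc
          obtain ⟨y, hy, hy'⟩ := h t' ht'c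
          exact absurd (ht hy) (not_le.2 (htt'.trans_le hy'))
        obtain ⟨u', hu'c, hu'⟩ := this
        refine ⟨d, min u u', ⟨y, hy, hdy⟩, ?_, ?_⟩
        · rintro ⟨z, hz, hz'⟩
          rcases le_total u u' with h | h
          · exact hu ⟨z, hz, by simpa [h] using hz'⟩
          · exact absurd (hu' z hz) (not_lt.2 (by simpa [h] using hz'))
        · intro p hp
          rcases Finset.mem_insert.1 hp with rfl | hp
          · exact Or.inr (min_lt_of_right_lt hu'c)
          · exact (hG p hp).imp id min_lt_of_left_lt
  obtain ⟨d, u, hd, hu, h⟩ := key F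
  have hdu : d < u := by
    by_contra! hud
    obtain ⟨y, hy, hdy⟩ := hd
    exact hu ⟨y, hy, hud.trans hdy⟩
  refine hu ((hF d u fun p hp => ?_).1 hd)
  rcases h p hp with h | h
  · exact ⟨iff_of_false h.not_gt (h.trans hdu).not_gt, iff_of_true h (h.trans hdu)⟩
  · exact ⟨iff_of_true (hdu.trans h) h, iff_of_false (hdu.trans h).not_gt h.not_gt⟩

theorem DMap.exists_isGLB [DenselyOrdered I] (hS : DMap I S) (hne : ∃ x, S x)
    (hbdd : ∃ b, ∀ x, S x → b ≤ x) : ∃ s, IsGLB {x | S x} s :=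
  DMap.exists_isLUB (I := Iᵒᵈ) (S := fun x => S (OrderDual.ofDual x)) hS hne hbdd

/-- A definable predicate is constant on an interval when it is locally constant there. -/
theorem DMap.iff_of_locally_const [DenselyOrdered I] (hS : DMap I S) {x y : I} (hxy : x ≤ y)
    (h : ∀ p, x ≤ p → p ≤ y → ∃ u v, u < p ∧ p < v ∧ ∀ q, u < q → q < v → (S q ↔ S p)) :
    S x ↔ S y := by
  have hT : DMap I fun t => x ≤ t ∧ t ≤ y ∧ ∀ q, x ≤ q → q ≤ t → (S q ↔ S x) := by fun_prop
  obtain ⟨s, hs⟩ := hT.exists_isLUB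
    ⟨x, le_rfl, hxy, fun q h1 h2 => by rw [h1.antisymm h2]⟩ ⟨y, fun t ht => ht.2.1⟩
  have hxs : x ≤ s := hs.1 ⟨le_rfl, hxy, fun q h1 h2 => by rw [h1.antisymm h2]⟩
  have hsy : s ≤ y := hs.2 fun t ht => ht.2.1
  obtain ⟨u, v, hus, hsv, huv⟩ := h s hxs hsy
  obtain ⟨t, ⟨hxt, hty, ht⟩, hut, hts⟩ := hs.exists_between hus
  have hsx : S s ↔ S x := (huv t hut (hts.trans_lt hsv)).symm.trans (ht t hxt le_rfl)
  rcases hsy.eq_or_lt with rfl | hlt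
  · exact hsx.symm
  · obtain ⟨s', hss', hs'⟩ := exists_between (lt_min hsv hlt)
    refine absurd (hs.1 ⟨hxs.trans hss'.le, (hs'.trans_le (min_le_right _ _)).le, ?_⟩)
      (not_le.2 hss')
    intro q hxq hqs'
    rcases le_or_gt q t with hqt | hqt
    · exact ht q hxq hqt
    · exact (huv q (hut.trans hqt) (hqs'.trans_lt (hs'.trans_le (min_le_left _ _)))).trans hsx

theorem DMap.finite_or_interval [NoMinOrder I] [NoMaxOrder I] (hS : DMap I S) :
    {x | S x}.Finite ∨ ∃ a b, a < b ∧ ∀ x, a < x → x < b → S x := by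
  obtain ⟨F, hF⟩ := hS.tame
  by_cases h : {x | S x} ⊆ F
  · exact Or.inl (F.finite_toSet.subset h)
  · obtain ⟨x, hx, hxF⟩ := Set.not_subset.1 h
    obtain ⟨b, hb⟩ := exists_gt x
    obtain ⟨q, hxq, -, hq⟩ := F.exists_gap_right hb
    obtain ⟨a, ha⟩ := exists_lt x
    obtain ⟨r, -, hrx, hr⟩ := F.exists_gap_left ha
    refine Or.inr ⟨r, q, hrx.trans hxq, fun y h1 h2 => (hF x y ?_).1 hx⟩
    refine sameCut_of_gap (a := r) (b := q) (fun p hp hrp => ?_) hrx hxq h1 h2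
    rcases lt_trichotomy p x with h | rfl | h
    · exact absurd (hr p hp h) (not_le.2 hrp)
    · exact absurd hp hxF
    · exact hq p hp h

end line

section monotonicity

variable {I : Type w} [LinearOrder I] {V : Type*} {f : I → V} {R : I → I → Prop} {a b : I}

/-- `f` is not constant on any subinterval of `(a, b)`. -/
def NowhereConst (f : I → V) (a b : I) : Prop :=
  ∀ c a' b', a ≤ a' → a' < b' → b' ≤ b → ∃ s, a' < s ∧ s < b' ∧ f s ≠ f c

theorem NowhereConst.mono (h : NowhereConst f a b) {a' b' : I} (ha : a ≤ a') (hb : b' ≤ b) :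
    NowhereConst f a' b' :=
  fun c a'' b'' h1 h2 h3 => h c a'' b'' (ha.trans h1) h2 (h3.trans hb)

theorem NowhereConst.dual (h : NowhereConst f a b) :
    NowhereConst (I := Iᵒᵈ) (fun t => f (OrderDual.ofDual t)) (OrderDual.toDual b)
      (OrderDual.toDual a) := by
  intro c a' b' h1 h2 h3
  obtain ⟨s, h4, h5, h6⟩ := h c b' a' h3 h2 h1
  exact ⟨s, h5, h4, h6⟩

variable [OMinSys I] [LinearOrder V]

theorem NowhereConst.sign_right (h : NowhereConst f a b)
    (hR : DMap I fun p : I × I => R p.1 p.2) (hRf : ∀ s t, R s t ↔ f s < f t)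
    (c : I) {t t' : I} (hat : a ≤ t) (htt' : t < t') (htb : t' ≤ b) :
    ∃ q, t < q ∧ q ≤ t' ∧
      ((∀ s, t < s → s < q → f c < f s) ∨ ∀ s, t < s → s < q → f s < f c) := by
  have h1 : DMap I fun s => R c s := by fun_prop
  have h2 : DMap I fun s => R s c := by fun_prop
  simp only [hRf] at h1 h2
  obtain ⟨q, htq, hqt', hq⟩ := h1.germ_right htt'
  obtain ⟨r, htr, hrq, hr⟩ := h2.germ_right htq
  refine ⟨r, htr, hrq.trans hqt', ?_⟩
  rcases hq with hq | hq
  · exact Or.inl fun s h1 h2 => hq s h1 (h2.trans_le hrq)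
  · rcases hr with hr | hr
    · exact Or.inr hr
    · obtain ⟨s, h3, h4, h5⟩ := h c t r hat htr ((hrq.trans hqt').trans htb)
      exact absurd ((not_lt.1 (hq s h3 (h4.trans_le hrq))).antisymm (not_lt.1 (hr s h3 h4))) h5

theorem NowhereConst.sign_left (h : NowhereConst f a b)
    (hR : DMap I fun p : I × I => R p.1 p.2) (hRf : ∀ s t, R s t ↔ f s < f t)
    (c : I) {t t' : I} (htb : t ≤ b) (htt' : t' < t) (hat : a ≤ t') :
    ∃ q, t' ≤ q ∧ q < t ∧
      ((∀ s, q < s → s < t → f c < f s) ∨ ∀ s, q < s → s < t → f s < f c) := by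
  have hR' : DMap Iᵒᵈ fun p : Iᵒᵈ × Iᵒᵈ => R (OrderDual.ofDual p.1) (OrderDual.ofDual p.2) := hR
  obtain ⟨q, h1, h2, h3⟩ := h.dual.sign_right hR' (fun s t => hRf _ _) (OrderDual.toDual c)
    (t := OrderDual.toDual t) (t' := OrderDual.toDual t') htb htt' hat
  exact ⟨q, h2, h1, h3.imp (fun h s h1 h2 => h s h2 h1) fun h s h1 h2 => h s h2 h1⟩

variable [DenselyOrdered I]

/-- If every point of `(a, b)` is a strict local minimum of `f`, then `f` drops through
some of its values. -/
theorem NowhereConst.exists_drop (h : NowhereConst f a b)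
    (hR : DMap I fun p : I × I => R p.1 p.2) (hRf : ∀ s t, R s t ↔ f s < f t) (hab : a < b)
    (hr : ∀ t, a < t → t < b → ∃ v, t < v ∧ ∀ s, t < s → s < v → f t < f s)
    (hl : ∀ t, a < t → t < b → ∃ u, u < t ∧ ∀ s, u < s → s < t → f t < f s) :
    ∃ e, a < e ∧ e < b ∧ ∃ c, (∃ u, u < e ∧ ∀ s, u < s → s < e → f c < f s) ∧
      ∃ v, e < v ∧ ∀ s, e < s → s < v → f s < f c := by
  have hB : DMap I fun x => ∀ y, x < y → y < b → R x y := by fun_prop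
  simp only [hRf] at hB
  obtain ⟨a', haa', ha'b, hB⟩ := hB.germ_left hab
  replace hB : ∀ x, a' < x → x < b → ∃ y, x < y ∧ y < b ∧ f y ≤ f x := by
    rcases hB with hB | hB
    · exfalso
      obtain ⟨x, h1, h2⟩ := exists_between ha'b
      obtain ⟨u, hux, hu⟩ := hl x (haa'.trans_lt h1) h2
      obtain ⟨s, h3, h4⟩ := exists_between (max_lt hux h1)
      exact lt_asymm (hu s ((le_max_left _ _).trans_lt h3) h4)
        (hB s ((le_max_right _ _).trans_lt h3) (h4.trans h2) x h4 h2)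
    · intro x h1 h2
      simpa using hB x h1 h2
  obtain ⟨c, ha'c, hcb⟩ := exists_between ha'b
  have hac := haa'.trans_lt ha'c
  obtain ⟨q, hcq, hqb, hq⟩ := h.sign_left hR hRf c le_rfl hcb hac.le
  rcases hq with hq | hq
  · exfalso
    have hD : DMap I fun d => c ≤ d ∧ d < b ∧ ∀ s, d < s → s < b → R c s := by fun_prop
    simp only [hRf] at hD
    obtain ⟨d, hd⟩ := hD.exists_isGLB ⟨q, hcq, hqb, hq⟩ ⟨c, fun x hx => hx.1⟩
    have hdq : d ≤ q := hd.1 ⟨hcq, hqb, hq⟩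
    have hcd : c ≤ d := hd.2 fun x hx => hx.1
    have hdb := hdq.trans_lt hqb
    have hdf : ∀ s, d < s → s < b → f c < f s := by
      intro s h1 h2
      obtain ⟨d', hd', -, hd's⟩ := hd.exists_between h1
      exact hd'.2.2 s hd's h2
    have hcd' : c < d := by
      refine hcd.lt_of_ne ?_
      rintro rfl
      obtain ⟨y, h1, h2, h3⟩ := hB c ha'c hcb
      exact absurd (hdf y h1 h2) (not_lt.2 h3)
    obtain ⟨y, h1, h2, h3⟩ := hB d (ha'c.trans hcd') hdb
    have hfd : f c < f d := (hdf y h1 h2).trans_le h3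
    obtain ⟨u, hud, hu⟩ := hl d (hac.trans hcd') hdb
    refine absurd (?_ : d ≤ max u c) (not_le.2 (max_lt hud hcd'))
    refine hd.1 ⟨le_max_right _ _, (max_lt hud hcd').trans hdb, fun s h4 h5 => ?_⟩
    rcases lt_trichotomy s d with h6 | rfl | h6
    · exact hfd.trans (hu s ((le_max_left _ _).trans_lt h4) h6)
    · exact hfd
    · exact hdf s h6 h5
  · have hE : DMap I fun e => c ≤ e ∧ e < b ∧ ∀ s, e < s → s < b → R s c := by fun_prop
    simp only [hRf] at hE
    obtain ⟨e, he⟩ := hE.exists_isGLB ⟨q, hcq, hqb, hq⟩ ⟨c, fun x hx => hx.1⟩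
    have heq : e ≤ q := he.1 ⟨hcq, hqb, hq⟩
    have hce : c ≤ e := he.2 fun x hx => hx.1
    have heb := heq.trans_lt hqb
    have hef : ∀ s, e < s → s < b → f s < f c := by
      intro s h1 h2
      obtain ⟨d', hd', -, hd's⟩ := he.exists_between h1
      exact hd'.2.2 s hd's h2
    have hce' : c < e := by
      refine hce.lt_of_ne ?_
      rintro rfl
      obtain ⟨v, hcv, hv⟩ := hr c hac hcb
      obtain ⟨s, h1, h2⟩ := exists_between (lt_min hcv hcb)
      exact lt_asymm (hv s h1 (h2.trans_le (min_le_left _ _)))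
        (hef s h1 (h2.trans_le (min_le_right _ _)))
    have hae := hac.trans hce'
    refine ⟨e, hae, heb, c, ?_, b, heb, hef⟩
    obtain ⟨r, hcr, hre, hr'⟩ := h.sign_left hR hRf c heb.le hce' hac.le
    rcases hr' with hr' | hr'
    · exact ⟨r, hre, hr'⟩
    · exfalso
      obtain ⟨u, hue, hu⟩ := hl e hae heb
      obtain ⟨s, h1, h2⟩ := exists_between (max_lt hue hre)
      have hfe : f e < f c := (hu s ((le_max_left _ _).trans_lt h1) h2).trans
        (hr' s ((le_max_right _ _).trans_lt h1) h2)
      refine absurd (he.1 ⟨hcr, hre.trans heb, fun s h4 h5 => ?_⟩) (not_le.2 hre)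
      rcases lt_trichotomy s e with h6 | rfl | h6
      · exact hr' s h4 h6
      · exact hfe
      · exact hef s h6 h5

theorem NowhereConst.not_local_min (h : NowhereConst f a b)
    (hR : DMap I fun p : I × I => R p.1 p.2) (hRf : ∀ s t, R s t ↔ f s < f t) (hab : a < b)
    (hr : ∀ t, a < t → t < b → ∃ v, t < v ∧ ∀ s, t < s → s < v → f t < f s)
    (hl : ∀ t, a < t → t < b → ∃ u, u < t ∧ ∀ s, u < s → s < t → f t < f s) : False := by
  have hΨ : DMap I fun e => ∃ c, (∃ u, u < e ∧ ∀ s, u < s → s < e → R c s) ∧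
      ∃ v, e < v ∧ ∀ s, e < s → s < v → R s c := by fun_prop
  simp only [hRf] at hΨ
  obtain ⟨q, haq, hqb, hq⟩ := hΨ.germ_left hab
  rcases hq with hq | hq
  · have hR' : DMap Iᵒᵈ fun p : Iᵒᵈ × Iᵒᵈ =>
        R (OrderDual.ofDual p.1) (OrderDual.ofDual p.2) := hR
    obtain ⟨e, h1, h2, c, ⟨v, hev, hv⟩, u, hue, hu⟩ := (h.mono haq le_rfl).dual.exists_drop hR'
      (fun s t => hRf _ _) hqb
      (fun t h1 h2 => (hl t (haq.trans_lt h2) h1).imp fun u hu => ⟨hu.1, fun s h3 h4 =>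
        hu.2 s h4 h3⟩)
      (fun t h1 h2 => (hr t (haq.trans_lt h2) h1).imp fun u hu => ⟨hu.1, fun s h3 h4 =>
        hu.2 s h4 h3⟩)
    obtain ⟨c', ⟨u', hue', hu'⟩, v', hev', hv'⟩ := hq e h2 h1
    obtain ⟨x, hx1, hx2⟩ := exists_between (max_lt (α := I) hue hue')
    obtain ⟨y, hy1, hy2⟩ := exists_between (lt_min (α := I) hev hev')
    have e1 := hu x hx2 ((le_max_left (α := I) _ _).trans_lt hx1)
    have e2 := hu' x ((le_max_right (α := I) _ _).trans_lt hx1) hx2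
    have e3 := hv y (hy2.trans_le (min_le_left (α := I) _ _)) hy1
    have e4 := hv' y hy1 (hy2.trans_le (min_le_right (α := I) _ _))
    exact lt_asymm (e1.trans e3) (e4.trans e2)
  · obtain ⟨e, h1, h2, h3⟩ := (h.mono haq le_rfl).exists_drop hR hRf hqb
      (fun t h1 h2 => hr t (haq.trans_lt h1) h2) (fun t h1 h2 => hl t (haq.trans_lt h1) h2)
    exact hq e h1 h2 h3

theorem strictMonoOn_of_local
    (hR : DMap I fun p : I × I => R p.1 p.2) (hRf : ∀ s t, R s t ↔ f s < f t)
    (hr : ∀ t, a < t → t < b → ∃ v, t < v ∧ ∀ s, t < s → s < v → f t < f s)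
    (hl : ∀ t, a < t → t < b → ∃ u, u < t ∧ ∀ s, u < s → s < t → f s < f t) :
    StrictMonoOn f (Set.Ioo a b) := by
  rintro x ⟨hax, hxb⟩ y ⟨hay, hyb⟩ hxy
  have hT : DMap I fun t => x < t ∧ t ≤ y ∧ ∀ s, x < s → s ≤ t → R x s := by fun_prop
  simp only [hRf] at hT
  obtain ⟨v, hxv, hv⟩ := hr x hax hxb
  obtain ⟨t₀, h1, h2⟩ := exists_between (lt_min hxv hxy)
  have ht₀ : x < t₀ ∧ t₀ ≤ y ∧ ∀ s, x < s → s ≤ t₀ → f x < f s :=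
    ⟨h1, (h2.trans_le (min_le_right _ _)).le, fun s h3 h4 =>
      hv s h3 (h4.trans_lt (h2.trans_le (min_le_left _ _)))⟩
  obtain ⟨t, ht⟩ := hT.exists_isLUB ⟨t₀, ht₀⟩ ⟨y, fun t ht => ht.2.1⟩
  have hxt : x < t := h1.trans_le (ht.1 ht₀)
  have hty : t ≤ y := ht.2 fun t ht => ht.2.1
  have hlt : ∀ s, x < s → s < t → f x < f s := by
    intro s h3 h4
    obtain ⟨t', ht', hst', -⟩ := ht.exists_between h4
    exact ht'.2.2 s h3 hst'.le
  have hft : f x < f t := by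
    obtain ⟨u, hut, hu⟩ := hl t (hax.trans hxt) (hty.trans_lt hyb)
    obtain ⟨s, h3, h4⟩ := exists_between (max_lt hut hxt)
    exact (hlt s ((le_max_right _ _).trans_lt h3) h4).trans
      (hu s ((le_max_left _ _).trans_lt h3) h4)
  rcases hty.eq_or_lt with rfl | hty
  · exact hft
  · exfalso
    obtain ⟨v, htv, hv⟩ := hr t (hax.trans hxt) (hty.trans hyb)
    obtain ⟨t', h3, h4⟩ := exists_between (lt_min htv hty)
    refine absurd (?_ : t' ≤ t) (not_le.2 h3)
    refine ht.1 ⟨hxt.trans h3, (h4.trans_le (min_le_right _ _)).le, fun s h5 h6 => ?_⟩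
    rcases lt_trichotomy s t with h7 | rfl | h7
    · exact hlt s h5 h7
    · exact hft
    · exact hft.trans (hv s h7 (h6.trans_lt (h4.trans_le (min_le_left _ _))))

theorem NowhereConst.exists_strictMonoOn (h : NowhereConst f a b)
    (hR : DMap I fun p : I × I => R p.1 p.2) (hRf : ∀ s t, R s t ↔ f s < f t) (hab : a < b) :
    ∃ b', a < b' ∧ b' ≤ b ∧
      (StrictMonoOn f (Set.Ioo a b') ∨ StrictAntiOn f (Set.Ioo a b')) := by
  have hRU : DMap I fun t => ∃ v, t < v ∧ ∀ s, t < s → s < v → R t s := by fun_prop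
  have hLU : DMap I fun t => ∃ u, u < t ∧ ∀ s, u < s → s < t → R t s := by fun_prop
  have hR' : DMap I fun p : I × I => R p.2 p.1 := by fun_prop
  have hRf' : ∀ s t, R t s ↔ OrderDual.toDual (f s) < OrderDual.toDual (f t) :=
    fun s t => hRf t s
  simp only [hRf] at hRU hLU
  obtain ⟨r, har, hrb, hr⟩ := hRU.germ_right hab
  obtain ⟨q, haq, hqr, hq⟩ := hLU.germ_right har
  refine ⟨q, haq, hqr.trans hrb, ?_⟩
  have h' := h.mono le_rfl (hqr.trans hrb)
  have hd : NowhereConst (fun t => OrderDual.toDual (f t)) a q := h'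
  replace hr : (∀ t, a < t → t < q → ∃ v, t < v ∧ ∀ s, t < s → s < v → f t < f s) ∨
      (∀ t, a < t → t < q → ∃ v, t < v ∧ ∀ s, t < s → s < v → f s < f t) := by
    refine hr.imp (fun hr t h1 h2 => hr t h1 (h2.trans_le hqr)) fun hr t h1 h2 => ?_
    obtain ⟨v, h3, h4, h5 | h5⟩ := h'.sign_right hR hRf t h1.le h2 le_rfl
    · exact absurd ⟨v, h3, h5⟩ (hr t h1 (h2.trans_le hqr))
    · exact ⟨v, h3, h5⟩
  replace hq : (∀ t, a < t → t < q → ∃ u, u < t ∧ ∀ s, u < s → s < t → f t < f s) ∨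
      (∀ t, a < t → t < q → ∃ u, u < t ∧ ∀ s, u < s → s < t → f s < f t) := by
    refine hq.imp id fun hr t h1 h2 => ?_
    obtain ⟨v, h3, h4, h5 | h5⟩ := h'.sign_left hR hRf t h2.le h1 le_rfl
    · exact absurd ⟨v, h4, h5⟩ (hr t h1 h2)
    · exact ⟨v, h4, h5⟩
  rcases hr with hr | hr <;> rcases hq with hq | hq
  · exact (h'.not_local_min hR hRf haq hr hq).elim
  · exact Or.inl (strictMonoOn_of_local hR hRf hr hq)
  · exact Or.inr (strictMonoOn_of_local (f := fun t => OrderDual.toDual (f t))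
      (R := fun s t => R t s) hR' hRf' hr hq)
  · exact (hd.not_local_min (R := fun s t => R t s) hR' hRf' haq hr hq).elim

end monotonicity

section germs

open Filter Topology

variable {I : Type w} [LinearOrder I]

section order

variable [TopologicalSpace I] [OrderTopology I] {a : I}

theorem Filter.Eventually.nhds_of_nhdsGT {P : I → Prop} (h : ∀ᶠ t in 𝓝[>] a, P t) :
    ∀ᶠ t in 𝓝[>] a, ∀ᶠ s in 𝓝 t, P s := by
  filter_upwards [eventually_eventually_nhdsWithin.2 h, self_mem_nhdsWithin] with t ht hat
  rwa [IsOpen.nhdsWithin_eq isOpen_Ioi hat] at ht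

theorem StrictMonoOn.exists_continuousAt {V : Type*} [LinearOrder V] [DenselyOrdered V]
    [TopologicalSpace V] [OrderTopology V] [NoMinOrder V] [NoMaxOrder V]
    {f : I → V} {a b : I} (hf : StrictMonoOn f (Set.Ioo a b)) {l r : V} (hlr : l < r)
    (him : ∀ y, l < y → y < r → ∃ t, a < t ∧ t < b ∧ f t = y) :
    ∃ t, a < t ∧ t < b ∧ ContinuousAt f t := by
  obtain ⟨y, hly, hyr⟩ := exists_between hlr
  obtain ⟨t, hat, htb, rfl⟩ := him y hly hyr
  refine ⟨t, hat, htb, tendsto_order.2 ⟨fun l' hl' => ?_, fun r' hr' => ?_⟩⟩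
  · obtain ⟨z, hz, hzt⟩ := exists_between (max_lt hl' hly)
    obtain ⟨s, has, hsb, rfl⟩ := him z ((le_max_right _ _).trans_lt hz) (hzt.trans hyr)
    have hst : s < t := (hf.lt_iff_lt ⟨has, hsb⟩ ⟨hat, htb⟩).1 hzt
    filter_upwards [Ioo_mem_nhds hst htb] with x hx
    exact ((le_max_left _ _).trans_lt hz).trans (hf ⟨has, hsb⟩ ⟨has.trans hx.1, hx.2⟩ hx.1)
  · obtain ⟨z, htz, hz⟩ := exists_between (lt_min hr' hyr)
    obtain ⟨s, has, hsb, rfl⟩ := him z (hly.trans htz) (hz.trans_le (min_le_right _ _))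
    have hts : t < s := (hf.lt_iff_lt ⟨hat, htb⟩ ⟨has, hsb⟩).1 htz
    filter_upwards [Ioo_mem_nhds hat hts] with x hx
    exact (hf ⟨hx.1, hx.2.trans hsb⟩ ⟨has, hsb⟩ hx.2).trans (hz.trans_le (min_le_left _ _))

variable [NoMaxOrder I]

theorem eventually_nhdsGT_iff {P : I → Prop} :
    (∀ᶠ t in 𝓝[>] a, P t) ↔ ∃ v, a < v ∧ ∀ t, a < t → t < v → P t := by
  rw [Filter.Eventually, mem_nhdsGT_iff_exists_Ioo_subset]
  constructor
  · rintro ⟨v, h1, h⟩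
    exact ⟨v, h1, fun t h3 h4 => h ⟨h3, h4⟩⟩
  · rintro ⟨v, h1, h⟩
    exact ⟨v, h1, fun t ht => h t ht.1 ht.2⟩

variable [NoMinOrder I]

theorem eventually_nhds_iff_Ioo {P : I → Prop} :
    (∀ᶠ t in 𝓝 a, P t) ↔ ∃ u v, u < a ∧ a < v ∧ ∀ t, u < t → t < v → P t := by
  rw [Filter.Eventually, mem_nhds_iff_exists_Ioo_subset]
  constructor
  · rintro ⟨u, v, ⟨h1, h2⟩, h⟩
    exact ⟨u, v, h1, h2, fun t h3 h4 => h ⟨h3, h4⟩⟩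
  · rintro ⟨u, v, h1, h2, h⟩
    exact ⟨u, v, ⟨h1, h2⟩, fun t ht => h t ht.1 ht.2⟩

theorem eventually_lt_and_lt_iff {f : I → I} {t : I} : ContinuousAt f t ↔
    ∀ l r, l < f t → f t < r → ∀ᶠ s in 𝓝 t, l < f s ∧ f s < r := by
  rw [ContinuousAt]
  constructor
  · intro h l r hl hr
    exact (h.eventually_const_lt hl).and (h.eventually_lt_const hr)
  · intro h
    obtain ⟨l, hl⟩ := exists_lt (f t)
    obtain ⟨r, hr⟩ := exists_gt (f t)
    exact tendsto_order.2 ⟨fun l hl => (h l r hl hr).mono fun s hs => hs.1,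
      fun r hr => (h l r hl hr).mono fun s hs => hs.2⟩

end order

variable [OMinSys I] {X : Type*} [Plots I X] {S : I → Prop}

@[fun_prop]
theorem DMap.isLUB {P : X → I → Prop} {g : X → I} (hP : DMap I fun p : X × I => P p.1 p.2)
    (hg : DMap I g) : DMap I fun x => IsLUB {y | P x y} (g x) := by
  have : DMap I fun x => (∀ y, P x y → y ≤ g x) ∧ ∀ b, (∀ y, P x y → y ≤ b) → g x ≤ b := by
    fun_prop
  exact this

@[fun_prop]
theorem DMap.isGLB {P : X → I → Prop} {g : X → I} (hP : DMap I fun p : X × I => P p.1 p.2)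
    (hg : DMap I g) : DMap I fun x => IsGLB {y | P x y} (g x) := by
  have : DMap I fun x => (∀ y, P x y → g x ≤ y) ∧ ∀ b, (∀ y, P x y → b ≤ y) → b ≤ g x := by
    fun_prop
  exact this

/-- Substituting the value of a function with definable graph into a definable predicate. -/
theorem DMap.graph_comp {f : I → I} (hf : DMap I fun p : I × I => f p.1 = p.2)
    {P : X → I → Prop} (hP : DMap I fun p : X × I => P p.1 p.2) {g : X → I} (hg : DMap I g) :
    DMap I fun x => P x (f (g x)) := by
  have h1 : DMap I fun p : X × I => f (g p.1) = p.2 :=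
    hf.comp' (g := fun p : X × I => (g p.1, p.2)) (by fun_prop)
  have : DMap I fun x => ∃ y, f (g x) = y ∧ P x y := by fun_prop
  simpa using this

variable [TopologicalSpace I] [OrderTopology I] [NoMaxOrder I]

@[fun_prop]
theorem DMap.eventually_nhdsGT {P : X → I → Prop} {g : X → I}
    (hP : DMap I fun p : X × I => P p.1 p.2) (hg : DMap I g) :
    DMap I fun x => ∀ᶠ t in 𝓝[>] (g x), P x t := by
  simp only [eventually_nhdsGT_iff]
  fun_prop

theorem DMap.eventually_or (hS : DMap I S) (a : I) :
    (∀ᶠ t in 𝓝[>] a, S t) ∨ ∀ᶠ t in 𝓝[>] a, ¬ S t := by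
  obtain ⟨b, hb⟩ := exists_gt a
  obtain ⟨q, hq, -, h⟩ := hS.germ_right hb
  simp only [eventually_nhdsGT_iff]
  exact h.imp (fun h => ⟨q, hq, h⟩) fun h => ⟨q, hq, h⟩

variable [NoMinOrder I]

@[fun_prop]
theorem DMap.eventually_nhds {P : X → I → Prop} {g : X → I}
    (hP : DMap I fun p : X × I => P p.1 p.2) (hg : DMap I g) :
    DMap I fun x => ∀ᶠ t in 𝓝 (g x), P x t := by
  simp only [eventually_nhds_iff_Ioo]
  fun_prop

theorem DMap.finite_of_germs (hS : DMap I S) (h : ∀ a, ¬ ∀ᶠ t in 𝓝[>] a, S t) :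
    {x | S x}.Finite := by
  refine hS.finite_or_interval.resolve_right ?_
  rintro ⟨a, b, hab, H⟩
  exact h a (eventually_nhdsGT_iff.2 ⟨b, hab, H⟩)

variable [DenselyOrdered I]

theorem exists_continuousAt_of_graph {f : I → I} (hf : DMap I fun p : I × I => f p.1 = p.2)
    {a b : I} (hab : a < b) : ∃ t, a < t ∧ t < b ∧ ContinuousAt f t := by
  by_cases hc : NowhereConst f a b
  · have hR : DMap I fun p : I × I => f p.1 < f p.2 := by
      have h1 : DMap I fun p : I × I => f p.1 < p.2 :=
        DMap.graph_comp hf (P := fun p : I × I => fun y => y < p.2) (by fun_prop) (by fun_prop)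
      exact DMap.graph_comp hf (P := fun p : I × I => fun y => f p.1 < y)
        (h1.comp' (g := fun q : (I × I) × I => (q.1.1, q.2)) (by fun_prop)) (by fun_prop)
    obtain ⟨b', hab', hb'b, hm⟩ := hc.exists_strictMonoOn hR (fun s t => Iff.rfl) hab
    have him : DMap I fun y => ∃ t, a < t ∧ t < b' ∧ f t = y := by
      have h1 : DMap I fun p : I × I => f p.2 = p.1 :=
        hf.comp' (g := fun p : I × I => (p.2, p.1)) (by fun_prop)
      fun_prop
    have hinj : Set.InjOn f (Set.Ioo a b') := hm.elim StrictMonoOn.injOn StrictAntiOn.injOn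
    have hinf : {y | ∃ t, a < t ∧ t < b' ∧ f t = y}.Infinite := by
      refine ((Set.infinite_image_iff hinj).2 (Set.Ioo_infinite hab')).mono ?_
      rintro _ ⟨t, ht, rfl⟩
      exact ⟨t, ht.1, ht.2, rfl⟩
    obtain ⟨l, r, hlr, h⟩ := him.finite_or_interval.resolve_left hinf
    have : ∃ t, a < t ∧ t < b' ∧ ContinuousAt f t := by
      rcases hm with hm | hm
      · exact hm.exists_continuousAt hlr h
      · exact StrictMonoOn.exists_continuousAt (V := Iᵒᵈ) (f := fun t => OrderDual.toDual (f t))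
          hm (l := r) (r := l) hlr fun y h1 h2 => h y h2 h1
    obtain ⟨t, h1, h2, h3⟩ := this
    exact ⟨t, h1, h2.trans_le hb'b, h3⟩
  · simp only [NowhereConst, not_forall, not_exists, not_and, not_not] at hc
    obtain ⟨c, a', b', h1, h2, h3, h⟩ := hc
    obtain ⟨t, h4, h5⟩ := exists_between h2
    refine ⟨t, h1.trans_lt h4, h5.trans_le h3, ?_⟩
    have : f =ᶠ[𝓝 t] fun _ => f c := by
      filter_upwards [Ioo_mem_nhds h4 h5] with s hs using h s hs.1 hs.2
    exact this.continuousAt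

/-- A definable functional relation has germs at `a` given by continuous functions. -/
theorem exists_continuous_selection {F : I → I → Prop} (hF : DMap I fun p : I × I => F p.1 p.2)
    (huniq : ∀ s y y', F s y → F s y' → y = y') {a : I} (hex : ∀ᶠ s in 𝓝[>] a, ∃ y, F s y) :
    ∃ f : I → I, DMap I (fun p : I × I => f p.1 = p.2) ∧
      (∀ᶠ s in 𝓝[>] a, F s (f s)) ∧ ∀ᶠ s in 𝓝[>] a, ContinuousAt f s := by
  classical
  let f : I → I := fun s => if h : ∃ y, F s y then h.choose else a
  have hfs : ∀ s, (∃ y, F s y) → F s (f s) := by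
    intro s h
    simp only [f, dif_pos h]
    exact h.choose_spec
  have hf : DMap I fun p : I × I => f p.1 = p.2 := by
    have : DMap I fun p : I × I => F p.1 p.2 ∨ ((¬ ∃ y, F p.1 y) ∧ a = p.2) := by fun_prop
    convert this using 2 with p
    by_cases h : ∃ y, F p.1 y
    · simp only [h, not_true_eq_false, false_and, or_false]
      exact ⟨fun h' => h' ▸ hfs _ h, fun h' => huniq _ _ _ (hfs _ h) h'⟩
    · have hfa : f p.1 = a := dif_neg h
      have : ¬ F p.1 p.2 := fun h' => h ⟨_, h'⟩
      simp [h, hfa, this]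
  refine ⟨f, hf, hex.mono hfs, ?_⟩
  have hc : DMap I fun t => ContinuousAt f t := by
    simp only [eventually_lt_and_lt_iff]
    have h1 : DMap I fun p : I × (I × I) => p.2.1 < f p.1 :=
      DMap.graph_comp hf (P := fun p : I × (I × I) => fun y => p.2.1 < y)
        (by fun_prop) (by fun_prop)
    have h2 : DMap I fun p : I × (I × I) => f p.1 < p.2.2 :=
      DMap.graph_comp hf (P := fun p : I × (I × I) => fun y => y < p.2.2)
        (by fun_prop) (by fun_prop)
    have h1' : DMap I fun p : I × I => p.1 < f p.2 :=
      h1.comp' (g := fun p : I × I => (p.2, (p.1, p.1))) (by fun_prop)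
    have h2' : DMap I fun p : I × I => f p.1 < p.2 :=
      h2.comp' (g := fun p : I × I => (p.1, (p.2, p.2))) (by fun_prop)
    have h1'' : ∀ {Y : Type w} [Plots I Y] (g k : Y → I), DMap I g → DMap I k →
        DMap I fun y => g y < f (k y) := fun g k hg hk =>
      h1'.comp' (g := fun y => (g y, k y)) (by fun_prop)
    have h2'' : ∀ {Y : Type w} [Plots I Y] (g k : Y → I), DMap I g → DMap I k →
        DMap I fun y => f (k y) < g y := fun g k hg hk =>
      h2'.comp' (g := fun y => (k y, g y)) (by fun_prop)
    refine .all (.all (.imp (h1'' _ _ ?_ ?_) (.imp (h2'' _ _ ?_ ?_)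
      (.eventually_nhds (.and (h1'' _ _ ?_ ?_) (h2'' _ _ ?_ ?_)) ?_)))) <;> fun_prop
  refine (hc.eventually_or a).resolve_right fun h => ?_
  obtain ⟨b, hab, hb⟩ := eventually_nhdsGT_iff.1 h
  obtain ⟨t, h1, h2, h3⟩ := exists_continuousAt_of_graph hf hab
  exact hb t h1 h2 h3

end germs

section common

open Filter Topology

variable {I : Type w} [LinearOrder I] [TopologicalSpace I] {J : I → I → Prop} {S : I → Prop} {a : I}

/-- A family of sets of `r`-tuples with nonempty interior, in an iterated sense. -/
def Large : ∀ {r : ℕ}, ((Fin r → I) → Prop) → Prop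
  | 0, J => J ![]
  | _ + 1, J => ∃ c, ∀ᶠ t in 𝓝[>] c, Large fun t' => J (Matrix.vecCons t t')

variable [OMinSys I] [OrderTopology I] [NoMaxOrder I]

theorem DMap.large {r : ℕ} {X : Type w} [Plots I X] {J : X → (Fin r → I) → Prop}
    (hJ : DMap I fun p : X × (Fin r → I) => J p.1 p.2) : DMap I fun x => Large (J x) := by
  induction r generalizing X with
  | zero => exact hJ.comp' (g := fun x => (x, ![])) (by fun_prop)
  | succ r ih =>
    have : DMap I fun p : X × I => Large fun t' => J p.1 (Matrix.vecCons p.2 t') :=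
      ih (J := fun p : X × I => fun t' => J p.1 (Matrix.vecCons p.2 t'))
        (hJ.comp' (g := fun q : (X × I) × (Fin r → I) => (q.1.1, Matrix.vecCons q.1.2 q.2))
          (by fun_prop))
    change DMap I fun x => ∃ c, ∀ᶠ t in 𝓝[>] c, Large fun t' => J x (Matrix.vecCons t t')
    fun_prop

variable [DenselyOrdered I]

theorem DMap.germ_of_isGLB (hS : DMap I S) {g : I}
    (hg : IsGLB {c | ∀ᶠ t in 𝓝[>] c, S t} g) : ∀ᶠ t in 𝓝[>] g, S t := by
  refine (hS.eventually_or g).resolve_right fun h => ?_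
  obtain ⟨v, hgv, hv⟩ := eventually_nhdsGT_iff.1 h
  obtain ⟨c, hc, hgc, hcv⟩ := hg.exists_between hgv
  rw [Set.mem_ofPred_eq] at hc
  obtain ⟨t, h1, h2, h3⟩ := (hc.and (Ioo_mem_nhdsGT hcv)).exists
  exact hv t (hgc.trans_lt h2) h3 h1

theorem DMap.exists_Iio_of_germs (hS : DMap I S) (a : I)
    (h : ∀ b, ∃ c, c < b ∧ ∀ᶠ t in 𝓝[>] c, S t) : ∃ r, ∀ t, t < r → S t := by
  classical
  have : Nonempty I := ⟨a⟩
  obtain ⟨F, hF⟩ := hS.tame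
  obtain ⟨b, hb⟩ := F.bddBelow
  obtain ⟨c, hcb, hc⟩ := h b
  obtain ⟨t, h1, h2, h3⟩ := (hc.and (Ioo_mem_nhdsGT hcb)).exists
  refine ⟨b, fun x hx => (hF t x fun p hp => ?_).1 h1⟩
  have hbp : b ≤ p := hb hp
  exact ⟨iff_of_true (h3.trans_le hbp) (hx.trans_le hbp),
    iff_of_false (h3.trans_le hbp).not_gt (hx.trans_le hbp).not_gt⟩

variable [NoMinOrder I]

/-- In a definable family of sets with nonempty interior, nearby members share points. -/
theorem exists_common_point (hJ : DMap I fun p : I × I => J p.1 p.2)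
    (h : ∀ᶠ s in 𝓝[>] a, ∃ c, ∀ᶠ t in 𝓝[>] c, J s t) :
    ∃ᶠ s₀ in 𝓝[>] a, ∃ t, ∀ᶠ s in 𝓝 s₀, J s t := by
  have hJs : ∀ s, DMap I fun t => J s t := fun s => by fun_prop
  have hB : DMap I fun s => ∃ b, ∀ c, (∀ᶠ t in 𝓝[>] c, J s t) → b ≤ c := by fun_prop
  rcases hB.eventually_or a with hb | hb
  · obtain ⟨g, hg, hgF, hgc⟩ := exists_continuous_selection
      (F := fun s y => IsGLB {c | ∀ᶠ t in 𝓝[>] c, J s t} y) (a := a) (by fun_prop)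
      (fun s y y' h1 h2 => h1.unique h2) (by
        filter_upwards [hb, h] with s hs hs'
        have : DMap I fun c => ∀ᶠ t in 𝓝[>] c, J s t := by fun_prop
        exact this.exists_isGLB hs' hs)
    have hgG : ∀ᶠ s in 𝓝[>] a, ∀ᶠ t in 𝓝[>] (g s), J s t :=
      hgF.mono fun s hs => (hJs s).germ_of_isGLB hs
    have hH : DMap I fun p : I × I => ∀ t, g p.1 < t → t < p.2 → J p.1 t :=
      DMap.graph_comp hg (P := fun p : I × I => fun y => ∀ t, y < t → t < p.2 → J p.1 t)
        (by fun_prop) (by fun_prop)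
    have hHB : DMap I fun s => ∃ b, ∀ r, (∀ t, g s < t → t < r → J s t) → r ≤ b :=
      .ex (.all (.imp (hH.comp' (g := fun p : (I × I) × I => (p.1.1, p.2)) (by fun_prop))
        (by fun_prop)))
    rcases hHB.eventually_or a with hb' | hb'
    · obtain ⟨k, -, hkF, hkc⟩ := exists_continuous_selection
        (F := fun s y => IsLUB {r | ∀ t, g s < t → t < r → J s t} y) (a := a)
        (.isLUB (hH.comp' (g := fun p : (I × I) × I => (p.1.1, p.2)) (by fun_prop)) (by fun_prop))
        (fun s y y' h1 h2 => h1.unique h2) (by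
          filter_upwards [hb'] with s hs
          have : DMap I fun r => ∀ t, g s < t → t < r → J s t :=
            hH.comp' (g := fun r => (s, r)) (by fun_prop)
          exact this.exists_isLUB ⟨g s, fun t h1 h2 => absurd h2 h1.not_gt⟩ hs)
      have hkJ := hkF.nhds_of_nhdsGT
      refine Filter.Eventually.frequently ?_
      filter_upwards [hgG, hgc, hkF, hkc, hkJ] with s₀ e1 e2 e3 e4 e5
      obtain ⟨v, hv, hvJ⟩ := eventually_nhdsGT_iff.1 e1
      obtain ⟨c, hc1, hc2⟩ := exists_between (hv.trans_le (e3.1 hvJ))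
      refine ⟨c, ?_⟩
      filter_upwards [e2.eventually_lt_const hc1, e4.eventually_const_lt hc2, e5] with s h1 h2 h3
      obtain ⟨r, hr, hcr, -⟩ := h3.exists_between h2
      exact hr c h1 hcr
    · refine Filter.Eventually.frequently ?_
      filter_upwards [hgc, hb'.nhds_of_nhdsGT] with s₀ e1 e2
      obtain ⟨c, hc⟩ := exists_gt (g s₀)
      refine ⟨c, ?_⟩
      filter_upwards [e1.eventually_lt_const hc, e2] with s h1 h2
      push Not at h2
      obtain ⟨r, hr, hcr⟩ := h2 c
      exact hr c h1 hcr
  · have hI : ∀ᶠ s in 𝓝[>] a, ∃ r, ∀ t, t < r → J s t := by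
      filter_upwards [hb] with s hs
      refine (hJs s).exists_Iio_of_germs a fun b => ?_
      by_contra h'
      refine hs ⟨b, fun c hc => ?_⟩
      by_contra! hcb
      exact h' ⟨c, hcb, hc⟩
    obtain ⟨k, -, hkF, hkc⟩ := exists_continuous_selection
      (F := fun s y => IsLUB {r | r ≤ a ∧ ∀ t, t < r → J s t} y) (a := a) (by fun_prop)
      (fun s y y' h1 h2 => h1.unique h2) (by
        filter_upwards [hI] with s hs
        obtain ⟨r, hr⟩ := hs
        have : DMap I fun r => r ≤ a ∧ ∀ t, t < r → J s t := by fun_prop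
        exact this.exists_isLUB ⟨min r a, min_le_right _ _,
          fun t ht => hr t (ht.trans_le (min_le_left _ _))⟩ ⟨a, fun x hx => hx.1⟩)
    refine Filter.Eventually.frequently ?_
    filter_upwards [hkc, hkF.nhds_of_nhdsGT] with s₀ e1 e2
    obtain ⟨c, hc⟩ := exists_lt (k s₀)
    refine ⟨c, ?_⟩
    filter_upwards [e1.eventually_const_lt hc, e2] with s h1 h2
    obtain ⟨r, hr, hcr, -⟩ := h2.exists_between h1
    exact hr.2 c hcr

theorem exists_common_tuple {r : ℕ} {J : I → (Fin r → I) → Prop}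
    (hJ : DMap I fun p : I × (Fin r → I) => J p.1 p.2) (h : ∀ᶠ s in 𝓝[>] a, Large (J s)) :
    ∃ᶠ s₀ in 𝓝[>] a, ∃ t, ∀ᶠ s in 𝓝 s₀, J s t := by
  induction r generalizing a with
  | zero =>
    refine Filter.Eventually.frequently ?_
    filter_upwards [h.nhds_of_nhdsGT] with s hs using ⟨![], hs⟩
  | succ r ih =>
    have hL : DMap I fun p : I × I => Large fun t' => J p.1 (Matrix.vecCons p.2 t') :=
      DMap.large (J := fun p : I × I => fun t' => J p.1 (Matrix.vecCons p.2 t'))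
        (hJ.comp' (g := fun q : (I × I) × (Fin r → I) => (q.1.1, Matrix.vecCons q.1.2 q.2))
          (by fun_prop))
    have h1 := exists_common_point hL h
    intro hno
    refine h1 ?_
    filter_upwards [hno.nhds_of_nhdsGT] with s₀ hs₀
    rintro ⟨t₁, ht₁⟩
    have h2 := ih (J := fun s t' => J s (Matrix.vecCons t₁ t')) (a := s₀)
      (hJ.comp' (g := fun q : I × (Fin r → I) => (q.1, Matrix.vecCons t₁ q.2)) (by fun_prop))
      (ht₁.filter_mono nhdsWithin_le_nhds)
    refine h2 ?_
    filter_upwards [hs₀.filter_mono nhdsWithin_le_nhds] with s hs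
    rintro ⟨t', ht'⟩
    exact hs ⟨_, ht'⟩

end common

section planar

open Filter Topology

variable {I : Type w} [LinearOrder I] [TopologicalSpace I] {A : I → I → Prop} {a t₀ : I}

/-- The set `A` misses a box around `(t, x)`. -/
def LocEmpty (A : I → I → Prop) (t x : I) : Prop :=
  ∃ l r, l < x ∧ x < r ∧ ∀ᶠ t' in 𝓝 t, ∀ x', l < x' → x' < r → ¬ A t' x'

/-- Around `(t, x)` the set `A` is the graph of a function continuous at `t`. -/
def LocSingle (A : I → I → Prop) (t x : I) : Prop :=
  A t x ∧ ∀ l₀ r₀, l₀ < x → x < r₀ → ∃ l r, l₀ ≤ l ∧ l < x ∧ x < r ∧ r ≤ r₀ ∧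
    ∀ᶠ t' in 𝓝 t, ∃ y, (l < y ∧ y < r ∧ A t' y) ∧ ∀ z, l < z → z < r → A t' z → z = y

/-- Near `t`, the fibres of `A` are uniformly bounded and `A` is locally a union of graphs. -/
def GoodAt (A : I → I → Prop) (t : I) : Prop :=
  (∃ l, ∀ᶠ t' in 𝓝 t, ∀ x, A t' x → l < x) ∧ (∃ r, ∀ᶠ t' in 𝓝 t, ∀ x, A t' x → x < r) ∧
    ∀ x, LocEmpty A t x ∨ LocSingle A t x

theorem LocEmpty.eventually [OrderTopology I] {t x : I} (h : LocEmpty A t x) :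
    ∀ᶠ y in 𝓝 x, LocEmpty A t y := by
  obtain ⟨l, r, hl, hr, h⟩ := h
  filter_upwards [Ioo_mem_nhds hl hr] with y hy using ⟨l, r, hy.1, hy.2, h⟩

theorem LocSingle.eventually [OrderTopology I] [DenselyOrdered I] [NoMinOrder I] [NoMaxOrder I]
    {t x : I} (h : LocSingle A t x) :
    ∀ᶠ y in 𝓝 x, LocEmpty A t y ∨ LocSingle A t y := by
  obtain ⟨l₀, hl₀⟩ := exists_lt x
  obtain ⟨r₀, hr₀⟩ := exists_gt x
  obtain ⟨l, r, -, hlx, hxr, -, hlr⟩ := h.2 l₀ r₀ hl₀ hr₀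
  filter_upwards [Ioo_mem_nhds hlx hxr] with y hy
  rcases lt_trichotomy y x with hyx | rfl | hyx
  · obtain ⟨c, hyc, hcx⟩ := exists_between hyx
    obtain ⟨l', r', hl', -, hr'x, hr', hlr'⟩ := h.2 c r hcx hxr
    refine Or.inl ⟨l, c, hy.1, hyc, ?_⟩
    filter_upwards [hlr, hlr'] with s hs hs' x' h1 h2 h3
    obtain ⟨y, -, hy'⟩ := hs
    obtain ⟨z, ⟨hz1, hz2, hz⟩, -⟩ := hs'
    have e1 := hy' x' h1 (h2.trans (hcx.trans hxr)) h3
    have e2 := hy' z (hy.1.trans (hyc.trans (hl'.trans_lt hz1))) (hz2.trans_le hr') hz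
    exact absurd (e1.trans e2.symm) (h2.trans (hl'.trans_lt hz1)).ne
  · exact Or.inr h
  · obtain ⟨c, hxc, hcy⟩ := exists_between hyx
    obtain ⟨l', r', hl', -, hr'x, hr', hlr'⟩ := h.2 l c hlx hxc
    refine Or.inl ⟨c, r, hcy, hy.2, ?_⟩
    filter_upwards [hlr, hlr'] with s hs hs' x' h1 h2 h3
    obtain ⟨y, -, hy'⟩ := hs
    obtain ⟨z, ⟨hz1, hz2, hz⟩, -⟩ := hs'
    have e1 := hy' x' (hlx.trans (hxc.trans h1)) h2 h3
    have e2 := hy' z (hl'.trans_lt hz1) ((hz2.trans_le hr').trans (hcy.trans hy.2)) hz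
    exact absurd (e1.trans e2.symm) ((hz2.trans_le hr').trans h1).ne'

variable [OMinSys I] [OrderTopology I] [NoMinOrder I] [NoMaxOrder I]

theorem DMap.goodAt {X : Type*} [Plots I X] {A : X → I → I → Prop}
    (hA : DMap I fun p : X × (I × I) => A p.1 p.2.1 p.2.2) {g : X → I} (hg : DMap I g) :
    DMap I fun x => GoodAt (A x) (g x) := by
  unfold GoodAt LocEmpty LocSingle
  fun_prop

variable [DenselyOrdered I]

theorem eventually_fibre_lower_bound (hA : DMap I fun p : I × I => A p.1 p.2)
    (hfin : ∀ t, {x | A t x}.Finite) (a : I) :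
    ∀ᶠ t₀ in 𝓝[>] a, ∃ l, ∀ᶠ t in 𝓝 t₀, ∀ x, A t x → l < x := by
  have hE : DMap I fun t => ∃ x, A t x := by fun_prop
  rcases hE.eventually_or a with h | h
  · obtain ⟨m, -, hm, hmc⟩ := exists_continuous_selection (a := a)
      (F := fun t y => A t y ∧ ∀ z, A t z → y ≤ z) (by fun_prop)
      (fun t y y' h1 h2 => (h1.2 _ h2.1).antisymm (h2.2 _ h1.1)) (by
        filter_upwards [h] with t ht
        exact Set.exists_min_image _ id (hfin t) ht)
    filter_upwards [hmc, hm.nhds_of_nhdsGT] with t₀ h1 h2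
    obtain ⟨l, hl⟩ := exists_lt (m t₀)
    refine ⟨l, ?_⟩
    filter_upwards [h2, h1.eventually_const_lt hl] with t h3 h4 x hx
    exact h4.trans_le (h3.2 x hx)
  · filter_upwards [h.nhds_of_nhdsGT] with t₀ h0
    refine ⟨a, ?_⟩
    filter_upwards [h0] with t ht x hx using absurd ⟨x, hx⟩ ht

theorem eventually_fibre_upper_bound (hA : DMap I fun p : I × I => A p.1 p.2)
    (hfin : ∀ t, {x | A t x}.Finite) (a : I) :
    ∀ᶠ t₀ in 𝓝[>] a, ∃ r, ∀ᶠ t in 𝓝 t₀, ∀ x, A t x → x < r := by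
  have hE : DMap I fun t => ∃ x, A t x := by fun_prop
  rcases hE.eventually_or a with h | h
  · obtain ⟨m, -, hm, hmc⟩ := exists_continuous_selection (a := a)
      (F := fun t y => A t y ∧ ∀ z, A t z → z ≤ y) (by fun_prop)
      (fun t y y' h1 h2 => (h2.2 _ h1.1).antisymm (h1.2 _ h2.1)) (by
        filter_upwards [h] with t ht
        exact Set.exists_max_image _ id (hfin t) ht)
    filter_upwards [hmc, hm.nhds_of_nhdsGT] with t₀ h1 h2
    obtain ⟨r, hr⟩ := exists_gt (m t₀)
    refine ⟨r, ?_⟩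
    filter_upwards [h2, h1.eventually_lt_const hr] with t h3 h4 x hx
    exact (h3.2 x hx).trans_lt h4
  · filter_upwards [h.nhds_of_nhdsGT] with t₀ h0
    refine ⟨a, ?_⟩
    filter_upwards [h0] with t ht x hx using absurd ⟨x, hx⟩ ht

theorem eventually_gap_left (hA : DMap I fun p : I × I => A p.1 p.2)
    (hfin : ∀ t, {x | A t x}.Finite) {β : I → I} (hβ : DMap I fun p : I × I => β p.1 = p.2) :
    ∀ᶠ t₀ in 𝓝[>] a, ∀ l₀ < β t₀, ∃ l, l₀ ≤ l ∧ l < β t₀ ∧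
      ∀ᶠ t in 𝓝 t₀, ∀ x, A t x → l < x → β t ≤ x := by
  have hlt : DMap I fun p : I × I => p.2 < β p.1 :=
    DMap.graph_comp hβ (P := fun p : I × I => fun y => p.2 < y) (by fun_prop) (by fun_prop)
  let B : I → I → Prop := fun t x => A t x ∧ x < β t
  have hB : DMap I fun p : I × I => B p.1 p.2 := hA.and hlt
  have hE : DMap I fun t => ∃ x, B t x := by fun_prop
  rcases hE.eventually_or a with h | h
  · obtain ⟨m, -, hm, hmc⟩ := exists_continuous_selection (a := a)
      (F := fun t y => B t y ∧ ∀ z, B t z → z ≤ y) (by fun_prop)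
      (fun t y y' h1 h2 => (h2.2 _ h1.1).antisymm (h1.2 _ h2.1)) (by
        filter_upwards [h] with t ht
        exact Set.exists_max_image _ id ((hfin t).subset fun x hx => hx.1) ht)
    filter_upwards [hmc, hm, hm.nhds_of_nhdsGT] with t₀ h1 h2 h3 l₀ hl₀
    obtain ⟨l, hl1, hl2⟩ := exists_between h2.1.2
    refine ⟨max l₀ l, le_max_left _ _, max_lt hl₀ hl2, ?_⟩
    filter_upwards [h3, h1.eventually_lt_const hl1] with t h4 h5 x hx hlx
    by_contra! hxβ
    exact absurd ((le_max_right _ _).trans_lt hlx) (not_lt.2 ((h4.2 x ⟨hx, hxβ⟩).trans h5.le))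
  · filter_upwards [h.nhds_of_nhdsGT] with t₀ h0 l₀ hl₀
    refine ⟨l₀, le_rfl, hl₀, ?_⟩
    filter_upwards [h0] with t ht x hx _
    by_contra! hxβ
    exact ht ⟨x, hx, hxβ⟩

theorem eventually_gap_right (hA : DMap I fun p : I × I => A p.1 p.2)
    (hfin : ∀ t, {x | A t x}.Finite) {β : I → I} (hβ : DMap I fun p : I × I => β p.1 = p.2) :
    ∀ᶠ t₀ in 𝓝[>] a, ∀ r₀, β t₀ < r₀ → ∃ r, r ≤ r₀ ∧ β t₀ < r ∧
      ∀ᶠ t in 𝓝 t₀, ∀ x, A t x → x < r → x ≤ β t := by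
  have hlt : DMap I fun p : I × I => β p.1 < p.2 :=
    DMap.graph_comp hβ (P := fun p : I × I => fun y => y < p.2) (by fun_prop) (by fun_prop)
  let B : I → I → Prop := fun t x => A t x ∧ β t < x
  have hB : DMap I fun p : I × I => B p.1 p.2 := hA.and hlt
  have hE : DMap I fun t => ∃ x, B t x := by fun_prop
  rcases hE.eventually_or a with h | h
  · obtain ⟨m, -, hm, hmc⟩ := exists_continuous_selection (a := a)
      (F := fun t y => B t y ∧ ∀ z, B t z → y ≤ z) (by fun_prop)
      (fun t y y' h1 h2 => (h1.2 _ h2.1).antisymm (h2.2 _ h1.1)) (by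
        filter_upwards [h] with t ht
        exact Set.exists_min_image _ id ((hfin t).subset fun x hx => hx.1) ht)
    filter_upwards [hmc, hm, hm.nhds_of_nhdsGT] with t₀ h1 h2 h3 r₀ hr₀
    obtain ⟨r, hr1, hr2⟩ := exists_between h2.1.2
    refine ⟨min r₀ r, min_le_left _ _, lt_min hr₀ hr1, ?_⟩
    filter_upwards [h3, h1.eventually_const_lt hr2] with t h4 h5 x hx hlx
    by_contra! hxβ
    exact absurd (hlx.trans_le (min_le_right _ _)) (not_lt.2 (h5.le.trans (h4.2 x ⟨hx, hxβ⟩)))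
  · filter_upwards [h.nhds_of_nhdsGT] with t₀ h0 r₀ hr₀
    refine ⟨r₀, le_rfl, hr₀, ?_⟩
    filter_upwards [h0] with t ht x hx _
    by_contra! hxβ
    exact ht ⟨x, hx, hxβ⟩

/-- Along the germ of a definable curve, `A` is locally empty or locally a graph. -/
theorem eventually_locEmpty_or_locSingle (hA : DMap I fun p : I × I => A p.1 p.2)
    (hfin : ∀ t, {x | A t x}.Finite) {β : I → I} (hβ : DMap I fun p : I × I => β p.1 = p.2)
    (hβc : ∀ᶠ t in 𝓝[>] a, ContinuousAt β t) :
    ∀ᶠ t in 𝓝[>] a, LocEmpty A t (β t) ∨ LocSingle A t (β t) := by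
  have hAβ : DMap I fun t => A t (β t) := DMap.graph_comp hβ hA (by fun_prop)
  rcases hAβ.eventually_or a with h | h
  · filter_upwards [eventually_gap_left hA hfin hβ, eventually_gap_right hA hfin hβ,
      hβc, h, h.nhds_of_nhdsGT] with t₀ hL hR hc h0 hn
    refine Or.inr ⟨h0, fun l₀ r₀ hl₀ hr₀ => ?_⟩
    obtain ⟨l, hl₀l, hl, hL⟩ := hL l₀ hl₀
    obtain ⟨r, hrr₀, hr, hR⟩ := hR r₀ hr₀
    refine ⟨l, r, hl₀l, hl, hr, hrr₀, ?_⟩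
    filter_upwards [hL, hR, hc.eventually_const_lt hl, hc.eventually_lt_const hr, hn]
      with t h1 h2 h3 h4 h5
    exact ⟨β t, ⟨h3, h4, h5⟩, fun z hz1 hz2 hz => (h2 z hz hz2).antisymm (h1 z hz hz1)⟩
  · filter_upwards [eventually_gap_left hA hfin hβ, eventually_gap_right hA hfin hβ,
      h.nhds_of_nhdsGT] with t₀ hL hR hn
    obtain ⟨l₀, hl₀⟩ := exists_lt (β t₀)
    obtain ⟨r₀, hr₀⟩ := exists_gt (β t₀)
    obtain ⟨l, -, hl, hL⟩ := hL l₀ hl₀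
    obtain ⟨r, -, hr, hR⟩ := hR r₀ hr₀
    refine Or.inl ⟨l, r, hl, hr, ?_⟩
    filter_upwards [hL, hR, hn] with t h1 h2 h3 z hz1 hz2 hz
    exact h3 ((h1 z hz hz1).antisymm (h2 z hz hz2) ▸ hz)

theorem eventually_goodAt (hA : DMap I fun p : I × I => A p.1 p.2)
    (hfin : ∀ t, {x | A t x}.Finite) (a : I) : ∀ᶠ t in 𝓝[>] a, GoodAt A t := by
  let Z : I → I → Prop := fun t x => ¬ (LocEmpty A t x ∨ LocSingle A t x)
  have hZ : DMap I fun p : I × I => Z p.1 p.2 := by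
    unfold Z LocEmpty LocSingle
    fun_prop
  have hlb := eventually_fibre_lower_bound hA hfin a
  have hE : DMap I fun t => ∃ x, Z t x := by fun_prop
  rcases hE.eventually_or a with h | h
  · exfalso
    obtain ⟨β, hβ, hβF, hβc⟩ := exists_continuous_selection (a := a)
      (F := fun t y => IsGLB {x | Z t x} y) (by fun_prop) (fun t y y' h1 h2 => h1.unique h2) (by
        filter_upwards [h, hlb] with t ht hl
        obtain ⟨l, hl⟩ := hl
        have hZt : DMap I fun x => Z t x := by fun_prop
        refine hZt.exists_isGLB ht ⟨l, fun x hx => ?_⟩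
        by_contra! hxl
        obtain ⟨l', hl'⟩ := exists_lt x
        exact hx (Or.inl ⟨l', l, hl', hxl, hl.mono fun t' ht' x' _ h1 h2 =>
          lt_asymm h1 (ht' x' h2)⟩))
    obtain ⟨t, h1, h2⟩ := (hβF.and (eventually_locEmpty_or_locSingle hA hfin hβ hβc)).exists
    have h3 : ∀ᶠ y in 𝓝 (β t), ¬ Z t y := by
      simp only [Z, not_not]
      exact h2.elim (fun h => h.eventually.mono fun y hy => Or.inl hy) LocSingle.eventually
    obtain ⟨u, v, hu, hv, h4⟩ := eventually_nhds_iff_Ioo.1 h3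
    obtain ⟨c, hc, hc1, hc2⟩ := h1.exists_between hv
    exact h4 c (hu.trans_le hc1) hc2 hc
  · filter_upwards [hlb, eventually_fibre_upper_bound hA hfin a, h] with t h1 h2 h3
    exact ⟨h1, h2, fun x => not_not.1 fun hx => h3 ⟨x, hx⟩⟩

theorem GoodAt.eventually_ncard_eq (hA : DMap I fun p : I × I => A p.1 p.2)
    (hfin : {x | A t₀ x}.Finite) (h : GoodAt A t₀) :
    ∀ᶠ t in 𝓝 t₀, {x | A t x}.ncard = {x | A t₀ x}.ncard := by
  classical
  obtain ⟨⟨lb, hlb⟩, ⟨ub, hub⟩, hloc⟩ := h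
  obtain ⟨U, hU, hdisj⟩ := hfin.t2_separation
  have hbox : ∀ x, ∃ l r, l < x ∧ x < r ∧ Set.Ioo l r ⊆ U x ∧ (A t₀ x → ∀ᶠ t in 𝓝 t₀,
      ∃ y, (l < y ∧ y < r ∧ A t y) ∧ ∀ z, l < z → z < r → A t z → z = y) := by
    intro x
    obtain ⟨l₀, r₀, ⟨hl₀, hr₀⟩, hlr⟩ :=
      mem_nhds_iff_exists_Ioo_subset.1 ((hU x).2.mem_nhds (hU x).1)
    by_cases hx : A t₀ x
    · have hs : LocSingle A t₀ x := by
        refine (hloc x).resolve_left ?_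
        rintro ⟨l, r, hl, hr, h⟩
        exact h.self_of_nhds x hl hr hx
      obtain ⟨l, r, h1, h2, h3, h4, h5⟩ := hs.2 l₀ r₀ hl₀ hr₀
      exact ⟨l, r, h2, h3, (Set.Ioo_subset_Ioo h1 h4).trans hlr, fun _ => h5⟩
    · exact ⟨l₀, r₀, hl₀, hr₀, hlr, fun h => absurd h hx⟩
  choose l r hl hr hlrU huniq using hbox
  set F := hfin.toFinset with hF
  have hFA : ∀ x, x ∈ F ↔ A t₀ x := fun x => by simp [hF]
  have hV : DMap I fun z => ∃ x ∈ F, l x < z ∧ z < r x := by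
    clear_value F
    clear hF hFA
    induction F using Finset.induction_on with
    | empty =>
      have : DMap I fun z : I => z < z := by fun_prop
      simpa using this
    | insert c F _ ih =>
      have : DMap I fun z => (l c < z ∧ z < r c) ∨ ∃ x ∈ F, l x < z ∧ z < r x := by fun_prop
      simpa [Finset.exists_mem_insert] using this
  have hcover : ∀ᶠ t in 𝓝 t₀, ∀ z, A t z → ∃ x ∈ F, l x < z ∧ z < r x := by
    have hS : DMap I fun y => ∀ᶠ t in 𝓝 t₀, ∀ z, z ≤ y → A t z → ∃ x ∈ F, l x < z ∧ z < r x := by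
      have : DMap I fun p : I × I => ∀ z, z ≤ p.1 → A p.2 z → ∃ x ∈ F, l x < z ∧ z < r x :=
        .all (.imp (by fun_prop) (.imp (by fun_prop) (hV.comp' (by fun_prop))))
      fun_prop
    have hconst : ∀ p, ∃ u v, u < p ∧ p < v ∧ ∀ q, u < q → q < v →
        ((∀ᶠ t in 𝓝 t₀, ∀ z, z ≤ q → A t z → ∃ x ∈ F, l x < z ∧ z < r x) ↔
          ∀ᶠ t in 𝓝 t₀, ∀ z, z ≤ p → A t z → ∃ x ∈ F, l x < z ∧ z < r x) := by
      intro p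
      have hp : ∃ u v, u < p ∧ p < v ∧ ∀ᶠ t in 𝓝 t₀, ∀ z, u < z → z < v → A t z →
          ∃ x ∈ F, l x < z ∧ z < r x := by
        rcases hloc p with ⟨u, v, hu, hv, h⟩ | h
        · exact ⟨u, v, hu, hv, h.mono fun t ht z h1 h2 h3 => absurd h3 (ht z h1 h2)⟩
        · exact ⟨l p, r p, hl p, hr p, Eventually.of_forall fun t z h1 h2 _ =>
            ⟨p, (hFA p).2 h.1, h1, h2⟩⟩
      obtain ⟨u, v, hu, hv, h⟩ := hp
      refine ⟨u, v, hu, hv, fun q hq1 hq2 => ⟨fun h' => ?_, fun h' => ?_⟩⟩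
      · filter_upwards [h, h'] with t e1 e2 z hz hAz
        rcases le_or_gt z q with h3 | h3
        · exact e2 z h3 hAz
        · exact e1 z (hq1.trans h3) (hz.trans_lt hv) hAz
      · filter_upwards [h, h'] with t e1 e2 z hz hAz
        rcases le_or_gt z p with h3 | h3
        · exact e2 z h3 hAz
        · exact e1 z (hu.trans h3) (hz.trans_lt hq2) hAz
    have hmin := hS.iff_of_locally_const (min_le_right lb ub) fun p _ _ => hconst p
    have hub' := hmin.1 (hlb.mono fun t ht z hz hAz =>
      absurd (ht z hAz) (not_lt.2 (hz.trans (min_le_left _ _))))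
    filter_upwards [hub, hub'] with t h1 h2 z hz using h2 z (h1 z hz).le hz
  have huniq' : ∀ᶠ t in 𝓝 t₀, ∀ x ∈ F, ∃ y, (l x < y ∧ y < r x ∧ A t y) ∧
      ∀ z, l x < z → z < r x → A t z → z = y := by
    rw [Filter.eventually_all_finset]
    exact fun x hx => huniq x ((hFA x).1 hx)
  filter_upwards [hcover, huniq'] with t h1 h2
  rw [Set.ncard_eq_toFinset_card _ hfin]
  choose! g hg hg' using h2
  have himg : {x | A t x} = ↑(F.image g) := by
    ext z
    simp only [Set.mem_ofPred_eq, Finset.coe_image, Set.mem_image, Finset.mem_coe]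
    constructor
    · intro hz
      obtain ⟨x, hx, h3, h4⟩ := h1 z hz
      exact ⟨x, hx, (hg' x hx z h3 h4 hz).symm⟩
    · rintro ⟨x, hx, rfl⟩
      exact (hg x hx).2.2
  rw [himg, Set.ncard_coe_finset, Finset.card_image_of_injOn]
  intro x hx x' hx' hxx'
  by_contra hne
  refine Set.disjoint_left.1 (hdisj ((hFA x).1 hx) ((hFA x').1 hx') hne)
    (hlrU x ⟨(hg x hx).1, (hg x hx).2.1⟩) ?_
  have := hlrU x' ⟨(hg x' hx').1, (hg x' hx').2.1⟩
  rwa [← hxx'] at this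

end planar

section counting

variable {I : Type w} [LinearOrder I]

theorem Set.Finite.succ_le_ncard_iff {S : Set I} (hS : S.Finite) {j : ℕ} :
    j + 1 ≤ S.ncard ↔ ∃ y ∈ S, j ≤ {z | z ∈ S ∧ z < y}.ncard := by
  constructor
  · intro h
    have hne : S.Nonempty := by
      rw [← Set.ncard_pos hS]
      omega
    obtain ⟨y, hy, hmax⟩ := Set.exists_max_image S id hS hne
    refine ⟨y, hy, ?_⟩
    have : {z | z ∈ S ∧ z < y} = S \ {y} := by
      ext z
      exact ⟨fun h => ⟨h.1, h.2.ne⟩, fun h => ⟨h.1, lt_of_le_of_ne (hmax z h.1) h.2⟩⟩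
    rw [this, Set.ncard_sdiff_singleton_of_mem hy]
    omega
  · rintro ⟨y, hy, h⟩
    have : {z | z ∈ S ∧ z < y} ⊂ S :=
      ⟨fun z hz => hz.1, fun h => lt_irrefl y (h hy).2⟩
    have := Set.ncard_lt_ncard this hS
    omega

variable [OMinSys I]

theorem DMap.true {X : Type*} [Plots I X] : DMap I fun _ : X => True := by
  have : DMap I fun _ : X => ∀ y : I, y ≤ y := by fun_prop
  simpa using this

theorem DMap.exTuple {X : Type w} [Plots I X] {r : ℕ} {P : X → (Fin r → I) → Prop}
    (hP : DMap I fun p : X × (Fin r → I) => P p.1 p.2) : DMap I fun x => ∃ t, P x t := by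
  induction r generalizing X with
  | zero =>
    have : DMap I fun x => P x ![] := hP.comp' (g := fun x => (x, ![])) (by fun_prop)
    convert this using 2 with x
    exact ⟨fun ⟨t, ht⟩ => by rwa [Subsingleton.elim ![] t], fun h => ⟨_, h⟩⟩
  | succ r ih =>
    have : DMap I fun x => ∃ s, ∃ t, P x (Matrix.vecCons s t) :=
      .ex (ih (P := fun (p : X × I) t => P p.1 (Matrix.vecCons p.2 t))
        (hP.comp' (g := fun q : (X × I) × (Fin r → I) => (q.1.1, Matrix.vecCons q.1.2 q.2))
          (by fun_prop)))
    convert this using 2 with x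
    exact Fin.exists_fin_succ_pi

theorem DMap.le_ncard {X : Type w} [Plots I X] {P : X → I → Prop}
    (hP : DMap I fun p : X × I => P p.1 p.2) (hfin : ∀ x, {y | P x y}.Finite) (j : ℕ) :
    DMap I fun x => j ≤ {y | P x y}.ncard := by
  induction j generalizing X with
  | zero => simpa using DMap.true
  | succ j ih =>
    have hiff : (fun x => j + 1 ≤ {y | P x y}.ncard) =
        fun x => ∃ y, P x y ∧ j ≤ {z | P x z ∧ z < y}.ncard :=
      funext fun x => propext (hfin x).succ_le_ncard_iff
    rw [hiff]
    refine .ex (.and hP (ih (P := fun (p : X × I) z => P p.1 z ∧ z < p.2) (by fun_prop) ?_))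
    exact fun p => (hfin p.1).subset fun z hz => hz.1

theorem DMap.ncard_eq {X : Type w} [Plots I X] {P : X → I → Prop}
    (hP : DMap I fun p : X × I => P p.1 p.2) (hfin : ∀ x, {y | P x y}.Finite) (j : ℕ) :
    DMap I fun x => {y | P x y}.ncard = j := by
  have := (hP.le_ncard hfin j).and (hP.le_ncard hfin (j + 1)).not
  convert this using 2 with x
  omega

end counting

section index

open Filter Topology

variable {I : Type w} [LinearOrder I] {C : I → Prop}

/-- The number of points of `C` below `s`. -/
noncomputable def cellIndex (C : I → Prop) (s : I) : ℕ := {p | C p ∧ p < s}.ncard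

theorem cellIndex_le (hC : {p | C p}.Finite) (s : I) : cellIndex C s ≤ {p | C p}.ncard :=
  Set.ncard_le_ncard (fun _ hp => hp.1) hC

theorem not_of_cellIndex_eq (hC : {p | C p}.Finite) {s s' p : I}
    (h : cellIndex C s = cellIndex C s') (hsp : s ≤ p) (hps' : p < s') : ¬ C p := by
  intro hp
  have : {p | C p ∧ p < s} ⊂ {p | C p ∧ p < s'} :=
    ⟨fun q hq => ⟨hq.1, hq.2.trans (hsp.trans_lt hps')⟩,
      fun h => hsp.not_gt (h (⟨hp, hps'⟩ : p ∈ {p | C p ∧ p < s'})).2⟩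
  exact (Set.ncard_lt_ncard this (hC.subset fun _ hq => hq.1)).ne h

theorem eventually_cellIndex_eq [TopologicalSpace I] [OrderTopology I] [NoMinOrder I]
    [NoMaxOrder I] (hC : {p | C p}.Finite) {s₀ : I} (hs₀ : ¬ C s₀) :
    ∀ᶠ s in 𝓝 s₀, cellIndex C s = cellIndex C s₀ ∧ ¬ C s := by
  obtain ⟨u, v, hu, hv, h⟩ := eventually_nhds_iff_Ioo.1 (hC.isClosed.isOpen_compl.mem_nhds hs₀)
  replace h : ∀ p, u < p → p < v → ¬ C p := h
  refine eventually_nhds_iff_Ioo.2 ⟨u, v, hu, hv, fun s h1 h2 => ⟨?_, h s h1 h2⟩⟩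
  unfold cellIndex
  congr 1
  ext p
  refine and_congr_right fun hp => ?_
  by_contra hne
  refine h p ?_ ?_ hp
  · by_contra! hpu
    exact hne (iff_of_true (hpu.trans_lt h1) (hpu.trans_lt hu))
  · by_contra! hpv
    exact hne (iff_of_false (h2.trans_le hpv).not_gt (hv.trans_le hpv).not_gt)

end index

section uniform

open Filter Topology

variable {I : Type w} [LinearOrder I] [TopologicalSpace I]

theorem Large.mono {r : ℕ} {J J' : (Fin r → I) → Prop} (h : Large J) (hJ : ∀ t, J t → J' t) :
    Large J' := by
  induction r with
  | zero => exact hJ _ h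
  | succ r ih =>
    obtain ⟨c, hc⟩ := h
    exact ⟨c, hc.mono fun t ht => ih ht fun t' => hJ _⟩

theorem large_of_forall [Nonempty I] {r : ℕ} {J : (Fin r → I) → Prop} (h : ∀ t, J t) :
    Large J := by
  induction r with
  | zero => exact h _
  | succ r ih => exact ⟨Classical.arbitrary I, Eventually.of_forall fun t => ih fun t' => h _⟩

/-- `s₀` has a neighbourhood over which the family `A` is well behaved for a common parameter. -/
def GoodPoint {r : ℕ} (A : I → (Fin r → I) → I → Prop) (J : I → (Fin r → I) → Prop)
    (s₀ : I) : Prop :=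
  ∃ t, (∀ᶠ s in 𝓝 s₀, J s t) ∧ GoodAt (fun s x => A s t x) s₀

variable [OMinSys I]

variable (I) in
/-- Uniform finiteness for families over `n`-tuples: in a definable family of finite sets whose
cardinality does not depend on the auxiliary parameter `t`, the cardinalities are bounded. -/
def UniformlyFinite (n : ℕ) : Prop :=
  ∀ (r : ℕ) (A : (Fin n → I) → (Fin r → I) → I → Prop) (J : (Fin n → I) → (Fin r → I) → Prop),
    DMap I (fun p : (Fin n → I) × (Fin r → I) × I => A p.1 p.2.1 p.2.2) →
    DMap I (fun p : (Fin n → I) × (Fin r → I) => J p.1 p.2) →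
    (∀ a t, {x | A a t x}.Finite) → (∀ a, Large (J a)) →
    (∀ a t t', J a t → J a t' → {x | A a t x}.ncard = {x | A a t' x}.ncard) →
    ∃ K, ∀ a t, J a t → {x | A a t x}.ncard ≤ K

theorem uniformlyFinite_zero : UniformlyFinite I 0 := by
  intro r A J _ _ _ _ hconst
  by_cases h : ∃ t, J ![] t
  · obtain ⟨t, ht⟩ := h
    refine ⟨{x | A ![] t x}.ncard, fun a t' ht' => ?_⟩
    obtain rfl := Subsingleton.elim ![] a
    exact (hconst _ _ _ ht' ht).le
  · refine ⟨0, fun a t ht => ?_⟩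
    obtain rfl := Subsingleton.elim ![] a
    exact absurd ⟨t, ht⟩ h

variable {n r : ℕ} {A : (Fin n → I) → I → (Fin r → I) → I → Prop}
  {J : (Fin n → I) → I → (Fin r → I) → Prop}

/-- The bound over a single point `s` selected by a definable condition `T`. -/
theorem UniformlyFinite.bound_of_subsingleton [Nonempty I] (ih : UniformlyFinite I n)
    (hA : DMap I fun p : (Fin n → I) × I × (Fin r → I) × I => A p.1 p.2.1 p.2.2.1 p.2.2.2)
    (hJ : DMap I fun p : (Fin n → I) × I × (Fin r → I) => J p.1 p.2.1 p.2.2)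
    (hfin : ∀ a s t, {x | A a s t x}.Finite) (hL : ∀ a s, Large (J a s))
    (hconst : ∀ a s t t', J a s t → J a s t' →
      {x | A a s t x}.ncard = {x | A a s t' x}.ncard)
    {T : (Fin n → I) → I → Prop} (hT : DMap I fun p : (Fin n → I) × I => T p.1 p.2)
    (hsub : ∀ a s s', T a s → T a s' → s = s') :
    ∃ K, ∀ a s t, T a s → J a s t → {x | A a s t x}.ncard ≤ K := by
  have hset : ∀ a s t, T a s → {x | ∃ s, T a s ∧ A a s t x} = {x | A a s t x} := by
    intro a s t hs
    ext x
    exact ⟨fun ⟨s', hs', hx⟩ => by rwa [Set.mem_ofPred_eq, hsub a s s' hs hs'],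
      fun hx => ⟨s, hs, hx⟩⟩
  have hset' : ∀ a t, (¬ ∃ s, T a s) → {x | ∃ s, T a s ∧ A a s t x} = ∅ := by
    intro a t h
    ext x
    exact ⟨fun ⟨s', hs', _⟩ => h ⟨s', hs'⟩, fun hx => hx.elim⟩
  have := ih r (fun a t x => ∃ s, T a s ∧ A a s t x)
    (fun a t => (∃ s, T a s ∧ J a s t) ∨ ¬ ∃ s, T a s) (by fun_prop) (by fun_prop) ?_ ?_ ?_
  · obtain ⟨K, hK⟩ := this
    refine ⟨K, fun a s t hs ht => ?_⟩
    rw [← hset a s t hs]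
    exact hK a t (Or.inl ⟨s, hs, ht⟩)
  · intro a t
    by_cases h : ∃ s, T a s
    · obtain ⟨s, hs⟩ := h
      rw [hset a s t hs]
      exact hfin a s t
    · rw [hset' a t h]
      exact Set.finite_empty
  · intro a
    by_cases h : ∃ s, T a s
    · obtain ⟨s, hs⟩ := h
      exact (hL a s).mono fun t ht => Or.inl ⟨s, hs, ht⟩
    · exact large_of_forall fun t => Or.inr h
  · intro a t t' h h'
    by_cases hT' : ∃ s, T a s
    · obtain ⟨s, hs, ht⟩ := h.resolve_right (not_not.2 hT')
      obtain ⟨s', hs', ht'⟩ := h'.resolve_right (not_not.2 hT')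
      obtain rfl := hsub a s s' hs hs'
      rw [hset a s t hs, hset a s t' hs]
      exact hconst a s t t' ht ht'
    · rw [hset' a t hT', hset' a t' hT']

/-- The bound over an open set `T` of points `s` on which the cardinality is constant. -/
theorem UniformlyFinite.bound_of_open [Nonempty I] (ih : UniformlyFinite I n)
    (hA : DMap I fun p : (Fin n → I) × I × (Fin r → I) × I => A p.1 p.2.1 p.2.2.1 p.2.2.2)
    (hJ : DMap I fun p : (Fin n → I) × I × (Fin r → I) => J p.1 p.2.1 p.2.2)
    (hfin : ∀ a s t, {x | A a s t x}.Finite) (hL : ∀ a s, Large (J a s))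
    {T : (Fin n → I) → I → Prop} (hT : DMap I fun p : (Fin n → I) × I => T p.1 p.2)
    (hopen : ∀ a s₀, T a s₀ → ∀ᶠ s in 𝓝 s₀, T a s)
    (hconst : ∀ a s s' t t', T a s → T a s' → J a s t → J a s' t' →
      {x | A a s t x}.ncard = {x | A a s' t' x}.ncard) :
    ∃ K, ∀ a s t, T a s → J a s t → {x | A a s t x}.ncard ≤ K := by
  have hset : ∀ a s t, T a s → {x | T a s ∧ A a s t x} = {x | A a s t x} :=
    fun a s t hs => by simp [hs]
  have hset' : ∀ a s t, ¬ T a s → {x | T a s ∧ A a s t x} = ∅ :=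
    fun a s t hs => by simp [hs]
  have := ih (r + 1)
    (fun a t x => T a (Matrix.vecHead t) ∧ A a (Matrix.vecHead t) (Matrix.vecTail t) x)
    (fun a t => (T a (Matrix.vecHead t) ∧ J a (Matrix.vecHead t) (Matrix.vecTail t)) ∨
      ¬ ∃ s, T a s) (by fun_prop) (by fun_prop) ?_ ?_ ?_
  · obtain ⟨K, hK⟩ := this
    refine ⟨K, fun a s t hs ht => ?_⟩
    have := hK a (Matrix.vecCons s t) (Or.inl ⟨hs, ht⟩)
    simpa [hs] using this
  · exact fun a t => (hfin _ _ _).subset fun x hx => hx.2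
  · intro a
    by_cases h : ∃ s, T a s
    · obtain ⟨s, hs⟩ := h
      refine ⟨s, ?_⟩
      filter_upwards [(hopen a s hs).filter_mono nhdsWithin_le_nhds] with s' hs'
      exact (hL a s').mono fun t ht => Or.inl ⟨hs', ht⟩
    · exact large_of_forall fun t => Or.inr h
  · intro a t t' h h'
    by_cases hT' : ∃ s, T a s
    · obtain ⟨hs, ht⟩ := h.resolve_right (not_not.2 hT')
      obtain ⟨hs', ht'⟩ := h'.resolve_right (not_not.2 hT')
      rw [hset _ _ _ hs, hset _ _ _ hs']
      exact hconst a _ _ _ _ hs hs' ht ht'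
    · rw [hset' _ _ _ (not_exists.1 hT' _), hset' _ _ _ (not_exists.1 hT' _)]

variable [OrderTopology I] [DenselyOrdered I] [NoMinOrder I] [NoMaxOrder I]

theorem finite_not_goodPoint {A : I → (Fin r → I) → I → Prop} {J : I → (Fin r → I) → Prop}
    (hA : DMap I fun p : I × (Fin r → I) × I => A p.1 p.2.1 p.2.2)
    (hJ : DMap I fun p : I × (Fin r → I) => J p.1 p.2)
    (hG : DMap I fun s => ¬ GoodPoint A J s)
    (hfin : ∀ s t, {x | A s t x}.Finite) (hL : ∀ s, Large (J s)) :
    {s | ¬ GoodPoint A J s}.Finite := by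
  refine hG.finite_of_germs fun a h => ?_
  refine exists_common_tuple hJ (a := a) (Eventually.of_forall hL) ?_
  filter_upwards [h.nhds_of_nhdsGT] with s₀ hs₀
  rintro ⟨t, ht⟩
  have hAt : DMap I fun p : I × I => A p.1 t p.2 :=
    hA.comp' (g := fun p : I × I => (p.1, t, p.2)) (by fun_prop)
  have hnhds : ∀ᶠ s in 𝓝[>] s₀, ∀ᶠ s' in 𝓝 s, J s' t :=
    (eventually_eventually_nhds.2 ht).filter_mono nhdsWithin_le_nhds
  obtain ⟨s, h1, h2, h3⟩ := ((eventually_goodAt hAt (fun s => hfin s t) s₀).and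
    (hnhds.and (hs₀.filter_mono nhdsWithin_le_nhds))).exists
  exact h3 ⟨t, h2, h1⟩

theorem ncard_eq_of_goodPoint {A : I → (Fin r → I) → I → Prop} {J : I → (Fin r → I) → Prop}
    (hA : DMap I fun p : I × (Fin r → I) × I => A p.1 p.2.1 p.2.2)
    (hJ : DMap I fun p : I × (Fin r → I) => J p.1 p.2)
    (hfin : ∀ s t, {x | A s t x}.Finite)
    (hconst : ∀ s t t', J s t → J s t' → {x | A s t x}.ncard = {x | A s t' x}.ncard)
    {s s' : I} (hss' : s ≤ s') (hgood : ∀ p, s ≤ p → p ≤ s' → GoodPoint A J p)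
    {t t' : Fin r → I} (ht : J s t) (ht' : J s' t') :
    {x | A s t x}.ncard = {x | A s' t' x}.ncard := by
  set k := {x | A s t x}.ncard with hk
  have hcard : DMap I fun p : I × (Fin r → I) => {x | A p.1 p.2 x}.ncard = k :=
    DMap.ncard_eq (P := fun (p : I × (Fin r → I)) x => A p.1 p.2 x)
      (hA.comp' (g := fun q : (I × (Fin r → I)) × I => (q.1.1, q.1.2, q.2)) (by fun_prop))
      (fun p => hfin _ _) k
  have hS : DMap I fun s => ∃ t, J s t ∧ {x | A s t x}.ncard = k := .exTuple (.and hJ hcard)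
  have := (hS.iff_of_locally_const hss' fun p hp1 hp2 => ?_).1 ⟨t, ht, rfl⟩
  · obtain ⟨t'', h1, h2⟩ := this
    rw [← h2]
    exact hconst _ _ _ h1 ht'
  · obtain ⟨c, hc, hgc⟩ := hgood p hp1 hp2
    have hAc : DMap I fun p : I × I => A p.1 c p.2 :=
      hA.comp' (g := fun p : I × I => (p.1, c, p.2)) (by fun_prop)
    have hn := hgc.eventually_ncard_eq hAc (hfin p c)
    obtain ⟨u, v, hu, hv, h⟩ := eventually_nhds_iff_Ioo.1 (hc.and hn)
    refine ⟨u, v, hu, hv, fun q hq1 hq2 => ?_⟩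
    have hJp := (h p hu hv).1
    obtain ⟨hJq, hq⟩ := h q hq1 hq2
    constructor
    · rintro ⟨d, hd, hdk⟩
      exact ⟨c, hJp, by rw [← hdk, ← hq]; exact hconst q _ _ hJq hd⟩
    · rintro ⟨d, hd, hdk⟩
      exact ⟨c, hJq, by rw [← hdk, hq]; exact hconst p _ _ hJp hd⟩

theorem UniformlyFinite.bound_succ [Nonempty I] (ih : UniformlyFinite I n)
    (hA : DMap I fun p : (Fin n → I) × I × (Fin r → I) × I => A p.1 p.2.1 p.2.2.1 p.2.2.2)
    (hJ : DMap I fun p : (Fin n → I) × I × (Fin r → I) => J p.1 p.2.1 p.2.2)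
    (hfin : ∀ a s t, {x | A a s t x}.Finite) (hL : ∀ a s, Large (J a s))
    (hconst : ∀ a s t t', J a s t → J a s t' →
      {x | A a s t x}.ncard = {x | A a s t' x}.ncard) :
    ∃ K, ∀ a s t, J a s t → {x | A a s t x}.ncard ≤ K := by
  let C : (Fin n → I) → I → Prop := fun a s => ¬ GoodPoint (A a) (J a) s
  have hC : DMap I fun p : (Fin n → I) × I => C p.1 p.2 := by
    refine .not (.exTuple (.and (by fun_prop) ?_))
    exact DMap.goodAt
      (A := fun (p : ((Fin n → I) × I) × (Fin r → I)) s x => A p.1.1 s p.2 x)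
      (by fun_prop) (by fun_prop)
  have hAa : ∀ a, DMap I fun p : I × (Fin r → I) × I => A a p.1 p.2.1 p.2.2 :=
    fun a => by fun_prop
  have hJa : ∀ a, DMap I fun p : I × (Fin r → I) => J a p.1 p.2 := fun a => by fun_prop
  have hCfin : ∀ a, {s | C a s}.Finite := fun a =>
    finite_not_goodPoint (hAa a) (hJa a) (show DMap I fun s => C a s by fun_prop) (hfin a) (hL a)
  obtain ⟨K₀, hK₀⟩ := ih 0 (fun a _ x => C a x) (fun _ _ => True) (by fun_prop) DMap.true
    (fun a _ => hCfin a) (fun _ => trivial) fun _ _ _ _ _ => rfl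
  have hidx : ∀ i, DMap I fun p : (Fin n → I) × I => cellIndex (C p.1) p.2 = i := fun i =>
    DMap.ncard_eq (P := fun (p : (Fin n → I) × I) q => C p.1 q ∧ q < p.2) (by fun_prop)
      (fun p => (hCfin p.1).subset fun q hq => hq.1) i
  have hpoint : ∀ i, ∃ K, ∀ a s t, (cellIndex (C a) s = i ∧ C a s) → J a s t →
      {x | A a s t x}.ncard ≤ K := by
    intro i
    refine ih.bound_of_subsingleton hA hJ hfin hL hconst
      (T := fun a s => cellIndex (C a) s = i ∧ C a s) ((hidx i).and hC) ?_
    intro a s s' hs hs'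
    rcases lt_trichotomy s s' with h | h | h
    · exact (not_of_cellIndex_eq (hCfin a) (hs.1.trans hs'.1.symm) le_rfl h hs.2).elim
    · exact h
    · exact (not_of_cellIndex_eq (hCfin a) (hs'.1.trans hs.1.symm) le_rfl h hs'.2).elim
  have hgap : ∀ i, ∃ K, ∀ a s t, (cellIndex (C a) s = i ∧ ¬ C a s) → J a s t →
      {x | A a s t x}.ncard ≤ K := by
    intro i
    refine ih.bound_of_open hA hJ hfin hL
      (T := fun a s => cellIndex (C a) s = i ∧ ¬ C a s) ((hidx i).and hC.not) ?_ ?_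
    · rintro a s₀ ⟨rfl, hs₀⟩
      exact eventually_cellIndex_eq (hCfin a) hs₀
    · have key : ∀ a s s' t t', s ≤ s' → (cellIndex (C a) s = i ∧ ¬ C a s) →
          (cellIndex (C a) s' = i ∧ ¬ C a s') → J a s t → J a s' t' →
          {x | A a s t x}.ncard = {x | A a s' t' x}.ncard := by
        intro a s s' t t' hss' hs hs' ht ht'
        refine ncard_eq_of_goodPoint (hAa a) (hJa a) (hfin a) (hconst a) hss' ?_ ht ht'
        intro p h1 h2
        rcases h2.eq_or_lt with rfl | h2
        · exact not_not.1 hs'.2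
        · exact not_not.1 (not_of_cellIndex_eq (hCfin a) (hs.1.trans hs'.1.symm) h1 h2)
      intro a s s' t t' hs hs' ht ht'
      rcases le_total s s' with h | h
      · exact key a s s' t t' h hs hs' ht ht'
      · exact (key a s' s t' t h hs' hs ht' ht).symm
  choose Kp hKp using hpoint
  choose Kg hKg using hgap
  refine ⟨(Finset.range (K₀ + 1)).sup fun i => max (Kp i) (Kg i), fun a s t ht => ?_⟩
  have hi : cellIndex (C a) s ∈ Finset.range (K₀ + 1) := by
    have := (cellIndex_le (hCfin a) s).trans (hK₀ a ![] trivial)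
    simp only [Finset.mem_range]
    omega
  refine le_trans ?_ (Finset.le_sup (f := fun i => max (Kp i) (Kg i)) hi)
  by_cases hs : C a s
  · exact (hKp _ a s t ⟨rfl, hs⟩ ht).trans (le_max_left _ _)
  · exact (hKg _ a s t ⟨rfl, hs⟩ ht).trans (le_max_right _ _)

theorem uniformlyFinite [Nonempty I] (n : ℕ) : UniformlyFinite I n := by
  induction n with
  | zero => exact uniformlyFinite_zero
  | succ n ih =>
    intro r A J hA hJ hfin hL hconst
    obtain ⟨K, hK⟩ := ih.bound_succ (A := fun a s => A (Matrix.vecCons s a))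
      (J := fun a s => J (Matrix.vecCons s a))
      (hA.comp' (g := fun p : (Fin n → I) × I × (Fin r → I) × I =>
        (Matrix.vecCons p.2.1 p.1, p.2.2.1, p.2.2.2)) (by fun_prop))
      (hJ.comp' (g := fun p : (Fin n → I) × I × (Fin r → I) =>
        (Matrix.vecCons p.2.1 p.1, p.2.2)) (by fun_prop))
      (fun _ _ => hfin _) (fun _ _ => hL _) (fun _ _ => hconst _)
    refine ⟨K, fun a t ht => ?_⟩
    have := hK (Matrix.vecTail a) (Matrix.vecHead a) t
    rw [Matrix.cons_head_tail] at this
    exact this ht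

end uniform

section cuts

variable {I : Type w} [LinearOrder I] [OMinSys I]

/-- The predicate `S` changes its truth value in every neighbourhood of `x`. -/
def IsJump (S : I → Prop) (x : I) : Prop :=
  ¬ ∃ u v, u < x ∧ x < v ∧ ∀ q, u < q → q < v → (S q ↔ S x)

theorem finite_isJump [NoMinOrder I] [NoMaxOrder I] {S : I → Prop} (hS : DMap I S) :
    {x | IsJump S x}.Finite := by
  obtain ⟨F, hF⟩ := hS.tame
  refine F.finite_toSet.subset fun x hx => ?_
  by_contra hxF
  obtain ⟨b, hb⟩ := exists_gt x
  obtain ⟨a, ha⟩ := exists_lt x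
  obtain ⟨v, hv, -, hv'⟩ := F.exists_gap_right hb
  obtain ⟨u, -, hu, hu'⟩ := F.exists_gap_left ha
  refine hx ⟨u, v, hu, hv, fun q hq1 hq2 => hF q x ?_⟩
  refine sameCut_of_gap (fun p hp hup => ?_) hq1 hq2 hu hv
  rcases lt_trichotomy p x with h | rfl | h
  · exact absurd (hu' p hp h) (not_le.2 hup)
  · exact absurd hp hxF
  · exact hv' p hp h

theorem iff_of_sameCut_isJump [DenselyOrdered I] {S : I → Prop} (hS : DMap I S) {x y : I}
    (h : SameCut {x | IsJump S x} x y) : S x ↔ S y := by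
  have key : ∀ x y, x ≤ y → SameCut {x | IsJump S x} x y → (S x ↔ S y) := by
    intro x y hxy h
    rcases hxy.eq_or_lt with rfl | hlt
    · rfl
    refine hS.iff_of_locally_const hxy fun p hp1 hp2 => ?_
    by_contra hp
    rcases hp1.eq_or_lt with rfl | hp1
    · exact lt_irrefl _ ((h _ hp).2.2 hlt)
    · exact ((h p hp).1.1 hp1).not_ge hp2
  rcases le_total x y with hxy | hxy
  · exact key x y hxy h
  · exact (key y x hxy fun p hp => ⟨(h p hp).1.symm, (h p hp).2.symm⟩).symm

/-- In a definable family of subsets of the line, the number of cells is bounded. -/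
theorem exists_uniform_cuts [DenselyOrdered I] [NoMinOrder I] [NoMaxOrder I] [Nonempty I]
    {m : ℕ} {S : (Fin m → I) → I → Prop}
    (hS : DMap I fun p : (Fin m → I) × I => S p.1 p.2) :
    ∃ K, ∀ a, ∃ z : Fin K → I, ∀ x y, SameCut (Set.range z) x y → (S a x ↔ S a y) := by
  let _ : TopologicalSpace I := Preorder.topology I
  have : OrderTopology I := ⟨rfl⟩
  have hSa : ∀ a, DMap I (S a) := fun a => hS.comp' (g := fun x => (a, x)) (by fun_prop)
  obtain ⟨K, hK⟩ := uniformlyFinite (I := I) m 0 (fun a _ x => IsJump (S a) x) (fun _ _ => True)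
    (by unfold IsJump; fun_prop) DMap.true (fun a _ => finite_isJump (hSa a)) (fun _ => trivial)
    fun _ _ _ _ _ => rfl
  refine ⟨K, fun a => ?_⟩
  have hfin := finite_isJump (hSa a)
  obtain ⟨z, hz⟩ : ∃ z : Fin (K) → I, {x | IsJump (S a) x} ⊆ Set.range z := by
    refine ⟨fun i => hfin.toFinset.toList.getD i (Classical.arbitrary I), fun x hx => ?_⟩
    have hx' : x ∈ hfin.toFinset.toList := by simpa using hx
    obtain ⟨i, hi, rfl⟩ := List.mem_iff_getElem.1 hx'
    have hiK : i < K := by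
      refine hi.trans_le ?_
      rw [Finset.length_toList, ← Set.ncard_eq_toFinset_card _ hfin]
      exact hK a ![] trivial
    exact ⟨⟨i, hiK⟩, List.getD_eq_getElem _ _ hi⟩
  exact ⟨z, fun x y h => iff_of_sameCut_isJump (hSa a) fun p hp => h p (hz hp)⟩

end cuts

section finUnion

variable {M : Type w} [LinearOrder M] {s : Set M}

theorem IsOpenIntervalSet.exists_cuts (hs : IsOpenIntervalSet s) :
    ∃ F : Finset M, ∀ x y, SameCut (F : Set M) x y → (x ∈ s ↔ y ∈ s) := by
  rcases hs with ⟨a, b, rfl⟩ | ⟨a, rfl⟩ | ⟨b, rfl⟩ | rfl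
  · refine ⟨{a, b}, fun x y h => and_congr (h a (by simp)).2 (h b (by simp)).1⟩
  · exact ⟨{a}, fun x y h => (h a (by simp)).2⟩
  · exact ⟨{b}, fun x y h => (h b (by simp)).1⟩
  · exact ⟨∅, fun x y _ => Iff.rfl⟩

theorem IsFinUnionPointsIntervals.exists_cuts (hs : IsFinUnionPointsIntervals s) :
    ∃ F : Finset M, ∀ x y, SameCut (F : Set M) x y → (x ∈ s ↔ y ∈ s) := by
  classical
  obtain ⟨F, n, J, hJ, rfl⟩ := hs
  choose G hG using fun k => (hJ k).exists_cuts
  refine ⟨F ∪ Finset.univ.biUnion G, fun x y h => ?_⟩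
  have key : ∀ {x y}, SameCut ((F ∪ Finset.univ.biUnion G : Finset M) : Set M) x y →
      x ∈ (F : Set M) ∪ ⋃ k, J k → y ∈ (F : Set M) ∪ ⋃ k, J k := by
    rintro x y h (hx | hx)
    · have := h x (Finset.mem_union_left _ hx)
      have hxy : x = y := le_antisymm (not_lt.1 fun hlt => lt_irrefl _ (this.1.2 hlt))
        (not_lt.1 fun hlt => lt_irrefl _ (this.2.2 hlt))
      exact Or.inl (hxy ▸ hx)
    · obtain ⟨k, hk⟩ := Set.mem_iUnion.1 hx
      refine Or.inr (Set.mem_iUnion.2 ⟨k, (hG k x y fun p hp => h p ?_).1 hk⟩)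
      exact Finset.mem_union_right _ (Finset.mem_biUnion.2 ⟨k, Finset.mem_univ _, hp⟩)
  exact ⟨key h, key fun p hp => ⟨(h p hp).1.symm, (h p hp).2.symm⟩⟩

end finUnion

section bounded

variable {L : FirstOrder.Language.{u, v}} [L.IsOrdered] {M : Type w} [LinearOrder M]
  [L.Structure M] [L.OrderedStructure M]

/-- The formula `i < j` in variables `i` and `j`. -/
def ltVar (L : FirstOrder.Language.{u, v}) [L.IsOrdered] {α : Type*} (i j : α) : L.Formula α :=
  Term.lt (Term.var (Sum.inl i)) (Term.var (Sum.inl j))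

theorem realize_ltVar {α : Type*} (i j : α) (v : α → M) :
    (ltVar L i j).Realize v ↔ v i < v j :=
  Term.realize_lt

/-- The trace on `Set.Iio e` of the definable sets of a downward o-minimal structure. -/
@[reducible]
def IsDownwardOMinimal.oMinSys (hM : IsDownwardOMinimal L M) (e : M) :
    OMinSys (Set.Iio e) where
  Dfn {Δ} P := ∃ φ : L.Formula (M ⊕ Δ), ∀ v : Δ → Set.Iio e,
    P v ↔ φ.Realize (Sum.elim id fun d => (v d : M))
  not := by
    rintro Δ P ⟨φ, hφ⟩
    exact ⟨φ.not, fun v => by simp only [Formula.realize_not, hφ]⟩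
  and := by
    rintro Δ P Q ⟨φ, hφ⟩ ⟨ψ, hψ⟩
    exact ⟨φ ⊓ ψ, fun v => by simp only [Formula.realize_inf, hφ, hψ]⟩
  ex := by
    rintro Δ P ⟨φ, hφ⟩
    let g : M ⊕ Option Δ → (M ⊕ Δ) ⊕ Unit :=
      Sum.elim (fun m => Sum.inl (Sum.inl m)) fun o =>
        o.elim (Sum.inr ()) fun d => Sum.inl (Sum.inr d)
    have hg : ∀ (v : Δ → Set.Iio e) (x : Set.Iio e) (i : Unit → M), i () = x →
        Sum.elim (Sum.elim id fun d => (v d : M)) i ∘ g =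
          Sum.elim id fun o : Option Δ => ((o.elim x v : Set.Iio e) : M) := by
      intro v x i hi
      funext o
      rcases o with m | _ | d
      exacts [rfl, hi, rfl]
    refine ⟨(φ.relabel g ⊓ ltVar L (Sum.inr ()) (Sum.inl (Sum.inl e))).iExs Unit, fun v => ?_⟩
    rw [Formula.realize_iExs]
    simp only [Formula.realize_inf, Formula.realize_relabel, realize_ltVar, hφ]
    constructor
    · rintro ⟨x, hx⟩
      exact ⟨fun _ => x, by rwa [hg v x _ rfl], x.2⟩
    · rintro ⟨i, hi, hlt⟩
      exact ⟨⟨i (), hlt⟩, by rwa [hg v ⟨i (), hlt⟩ i rfl] at hi⟩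
  subst := by
    rintro Γ Δ P f ⟨φ, hφ⟩ hf
    have hg : ∀ γ, ∃ o : M ⊕ Δ, ∀ v, (f v γ : M) = Sum.elim id (fun d => (v d : M)) o := by
      intro γ
      rcases hf γ with ⟨i, hi⟩ | ⟨c, hc⟩
      · exact ⟨Sum.inr i, fun v => congrArg Subtype.val (congrFun hi v)⟩
      · exact ⟨Sum.inl c, fun v => congrArg Subtype.val (congrFun hc v)⟩
    choose g hg using hg
    refine ⟨φ.relabel (Sum.elim Sum.inl g), fun v => ?_⟩
    simp only [hφ, Formula.realize_relabel]
    refine iff_of_eq (congrArg _ ?_)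
    funext o
    rcases o with m | γ
    exacts [rfl, hg γ v]
  lt := ⟨ltVar L (Sum.inr false) (Sum.inr true), fun v =>
    (realize_ltVar (L := L) (Sum.inr false) (Sum.inr true) (Sum.elim id fun d => (v d : M))).symm⟩
  tame := by
    rintro P ⟨φ, hφ⟩
    have hdef : (Set.univ : Set M).Definable₁ L
        {x | φ.Realize (Sum.elim id fun _ => x) ∧ x < e} := by
      refine Set.definable_iff_exists_formula_sum.2
        ⟨φ.relabel (Sum.map (fun m => ⟨m, trivial⟩) fun _ => 0) ⊓
          ltVar L (Sum.inr 0) (Sum.inl ⟨e, trivial⟩), ?_⟩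
      ext v
      simp only [Set.mem_ofPred_eq, Formula.realize_inf, Formula.realize_relabel, realize_ltVar]
      refine and_congr (iff_of_eq (congrArg _ ?_)) Iff.rfl
      funext o
      rcases o with m | _
      exacts [rfl, rfl]
    obtain ⟨F, hF⟩ := (hM _ hdef ⟨e, fun x hx => hx.2.le⟩).exists_cuts
    refine ⟨F.subtype (· ∈ Set.Iio e), fun x y h => ?_⟩
    rw [hφ, hφ]
    have := hF x y fun p hp => ?_
    · have hx : (x : M) < e := x.2
      have hy : (y : M) < e := y.2
      simpa [hx, hy] using this
    · rcases lt_or_ge p e with hpe | hpe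
      · exact h ⟨p, hpe⟩ (Finset.mem_coe.2 (Finset.mem_subtype.2 hp))
      · exact ⟨iff_of_true (x.2.trans_le hpe) (y.2.trans_le hpe),
          iff_of_false (x.2.trans_le hpe).not_gt (y.2.trans_le hpe).not_gt⟩

end bounded

section cells

variable {N : Type x} [LinearOrder N] {F : Finset N}

theorem Finset.exists_lower_neighbour (F : Finset N) (x : N) :
    (∃ a ∈ F, a < x ∧ ∀ p ∈ F, p < x → p ≤ a) ∨ ∀ p ∈ F, ¬ p < x := by
  rcases (F.filter (· < x)).eq_empty_or_nonempty with h | h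
  · exact Or.inr fun p hp hpx =>
      Finset.eq_empty_iff_forall_notMem.1 h p (Finset.mem_filter.2 ⟨hp, hpx⟩)
  · obtain ⟨a, ha, hmax⟩ := Finset.exists_max_image _ id h
    obtain ⟨haF, hax⟩ := Finset.mem_filter.1 ha
    exact Or.inl ⟨a, haF, hax, fun p hp hpx => hmax p (Finset.mem_filter.2 ⟨hp, hpx⟩)⟩

theorem Finset.exists_upper_neighbour (F : Finset N) (x : N) :
    (∃ b ∈ F, x < b ∧ ∀ p ∈ F, x < p → b ≤ p) ∨ ∀ p ∈ F, ¬ x < p :=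
  Finset.exists_lower_neighbour (N := Nᵒᵈ) F x

theorem isOpenIntervalSet_cell {x : N} (hx : x ∉ F) :
    IsOpenIntervalSet {y | SameCut (F : Set N) x y} := by
  have hmem : ∀ y, (∀ p ∈ F, (x < p → y < p) ∧ (p < x → p < y)) → SameCut (F : Set N) x y := by
    intro y h p hp
    rcases lt_trichotomy x p with hlt | rfl | hlt
    · have := (h p hp).1 hlt
      exact ⟨iff_of_true hlt this, iff_of_false hlt.not_gt this.not_gt⟩
    · exact absurd hp hx
    · have := (h p hp).2 hlt
      exact ⟨iff_of_false hlt.not_gt this.not_gt, iff_of_true hlt this⟩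
  rcases F.exists_lower_neighbour x with ⟨a, haF, hax, ha⟩ | ha <;>
    rcases F.exists_upper_neighbour x with ⟨b, hbF, hxb, hb⟩ | hb
  · refine Or.inl ⟨a, b, Set.ext fun y => ⟨fun h => ⟨(h a haF).2.1 hax, (h b hbF).1.1 hxb⟩,
      fun h => hmem y fun p hp => ⟨fun hlt => h.2.trans_le (hb p hp hlt),
        fun hlt => (ha p hp hlt).trans_lt h.1⟩⟩⟩
  · refine Or.inr (Or.inl ⟨a, Set.ext fun y => ⟨fun h => (h a haF).2.1 hax,
      fun h => hmem y fun p hp => ⟨fun hlt => absurd hlt (hb p hp),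
        fun hlt => (ha p hp hlt).trans_lt h⟩⟩⟩)
  · refine Or.inr (Or.inr (Or.inl ⟨b, Set.ext fun y => ⟨fun h => (h b hbF).1.1 hxb,
      fun h => hmem y fun p hp => ⟨fun hlt => h.trans_le (hb p hp hlt),
        fun hlt => absurd hlt (ha p hp)⟩⟩⟩))
  · refine Or.inr (Or.inr (Or.inr (Set.eq_univ_of_forall fun y =>
      hmem y fun p hp => ⟨fun hlt => absurd hlt (hb p hp), fun hlt => absurd hlt (ha p hp)⟩)))

theorem finite_cells (F : Finset N) :
    {c | ∃ x ∉ F, c = {y | SameCut (F : Set N) x y}}.Finite := by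
  classical
  refine (F.powerset.finite_toSet.image fun A =>
    {y | ∀ p ∈ F, (p ∉ A ↔ y < p) ∧ (p ∈ A ↔ p < y)}).subset ?_
  rintro c ⟨x, hx, rfl⟩
  refine ⟨F.filter (· < x), Finset.mem_coe.2 (Finset.mem_powerset.2 (Finset.filter_subset _ _)),
    Set.ext fun y => ?_⟩
  refine forall₂_congr fun p hp => ?_
  have hp' : p ∈ F := hp
  have hne : x ≠ p := fun h => hx (h ▸ hp)
  have hxp : x < p ↔ ¬ p < x := by rw [not_lt, hne.le_iff_lt]
  simp [hp', hxp]

theorem isFinUnionPointsIntervals_of_cuts {s : Set N}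
    (h : ∀ x y, SameCut (F : Set N) x y → (x ∈ s ↔ y ∈ s)) : IsFinUnionPointsIntervals s := by
  classical
  have hT : {c | ∃ x ∉ F, x ∈ s ∧ c = {y | SameCut (F : Set N) x y}}.Finite :=
    (finite_cells F).subset fun c ⟨x, hx, _, hc⟩ => ⟨x, hx, hc⟩
  have hT' := hT.toFinset.equivFin
  refine ⟨F.filter (· ∈ s), _, fun k => (hT'.symm k : Set N), fun k => ?_, ?_⟩
  · obtain ⟨x, hx, _, hc⟩ := hT.mem_toFinset.1 (hT'.symm k).2
    simp only [hc]
    exact isOpenIntervalSet_cell hx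
  · ext y
    constructor
    · intro hy
      by_cases hyF : y ∈ F
      · exact Or.inl (by simpa using ⟨hyF, hy⟩)
      · refine Or.inr (Set.mem_iUnion.2 ⟨hT' ⟨_, hT.mem_toFinset.2 ⟨y, hyF, hy, rfl⟩⟩, ?_⟩)
        rw [Equiv.symm_apply_apply]
        exact fun p _ => ⟨Iff.rfl, Iff.rfl⟩
    · rintro (hy | hy)
      · exact (Finset.mem_filter.1 hy).2
      · obtain ⟨k, hk⟩ := Set.mem_iUnion.1 hy
        obtain ⟨x, _, hxs, hc⟩ := hT.mem_toFinset.1 (hT'.symm k).2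
        rw [hc] at hk
        exact (h x y hk).1 hxs

end cells

section transfer

variable {L : FirstOrder.Language.{u, v}} [L.IsOrdered] {M : Type w} [LinearOrder M]
  [L.Structure M] [L.OrderedStructure M] {m : ℕ}

/-- Two points `x false` and `x true` below `e` in the same cell of the decomposition given by `z`
lie both in the fibre of `ψ` over `a` or both outside of it. -/
noncomputable def cellFormula (ψ : L.Formula (Fin m ⊕ Unit)) (K : ℕ) :
    L.Formula (((Unit ⊕ Fin m) ⊕ Fin K) ⊕ Bool) :=
  let e : ((Unit ⊕ Fin m) ⊕ Fin K) ⊕ Bool := Sum.inl (Sum.inl (Sum.inl ()))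
  let z : Fin K → ((Unit ⊕ Fin m) ⊕ Fin K) ⊕ Bool := fun k => Sum.inl (Sum.inr k)
  let x : Bool → ((Unit ⊕ Fin m) ⊕ Fin K) ⊕ Bool := Sum.inr
  let ψ' : Bool → L.Formula (((Unit ⊕ Fin m) ⊕ Fin K) ⊕ Bool) := fun b =>
    ψ.relabel (Sum.elim (fun i => Sum.inl (Sum.inl (Sum.inr i))) fun _ => x b)
  (ltVar L (x false) e).imp <| (ltVar L (x true) e).imp <|
    (Formula.iInf fun k =>
      (ltVar L (x false) (z k)).iff (ltVar L (x true) (z k)) ⊓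
        (ltVar L (z k) (x false)).iff (ltVar L (z k) (x true))).imp <|
      (ψ' false).iff (ψ' true)

/-- Below `e`, every fibre of `ψ` over a tuple below `e` is determined by cuts at `K` points. -/
noncomputable def cutsFormula (ψ : L.Formula (Fin m ⊕ Unit)) (K : ℕ) : L.Formula Unit :=
  Formula.iAlls (Fin m) <|
    (Formula.iInf fun i : Fin m => ltVar L (Sum.inr i) (Sum.inl ())).imp <|
      Formula.iExs (Fin K) <| Formula.iAlls Bool <| cellFormula ψ K

theorem realize_cutsFormula {ψ : L.Formula (Fin m ⊕ Unit)} {K : ℕ} {e : M} :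
    (cutsFormula ψ K).Realize (fun _ => e) ↔
      ∀ a : Fin m → M, (∀ i, a i < e) → ∃ z : Fin K → M, ∀ x y, x < e → y < e →
        SameCut (Set.range z) x y →
        (ψ.Realize (Sum.elim a fun _ => x) ↔ ψ.Realize (Sum.elim a fun _ => y)) := by
  have hrel : ∀ (a : Fin m → M) (z : Fin K → M) (w : Bool → M) (b : Bool),
      Sum.elim (Sum.elim (Sum.elim (fun _ : Unit => e) a) z) w ∘
        Sum.elim (fun i => Sum.inl (Sum.inl (Sum.inr i))) (fun _ : Unit => Sum.inr b) =
        Sum.elim a fun _ => w b := by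
    intro a z w b
    funext o
    rcases o with i | _
    exacts [rfl, rfl]
  simp only [cutsFormula, cellFormula, Formula.realize_iAlls, Formula.realize_iExs,
    Formula.realize_imp,
    Formula.realize_iInf, Formula.realize_inf, Formula.realize_iff, Formula.realize_relabel,
    realize_ltVar, Sum.elim_inl, Sum.elim_inr, hrel, SameCut, Set.forall_mem_range]
  refine forall₂_congr fun a _ => exists_congr fun z => ?_
  exact ⟨fun h x y => h fun b => bif b then y else x, fun h w => h _ _⟩

theorem IsDownwardOMinimal.realize_cutsFormula [DenselyOrdered M] [NoMinOrder M]
    (hM : IsDownwardOMinimal L M) (e : M) (ψ : L.Formula (Fin m ⊕ Unit)) :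
    ∃ K, (cutsFormula ψ K).Realize (fun _ => e) := by
  let _ : OMinSys (Set.Iio e) := hM.oMinSys e
  have hψ : OMinSys.Dfn fun v : Fin m ⊕ Unit → Set.Iio e => ψ.Realize fun o => (v o : M) :=
    ⟨ψ.relabel Sum.inr, fun v => by rw [Formula.realize_relabel, Sum.elim_comp_inr]⟩
  have hS : DMap (Set.Iio e) fun p : (Fin m → Set.Iio e) × Set.Iio e =>
      ψ.Realize fun o => ((Sum.elim p.1 (fun _ : Unit => p.2) o : Set.Iio e) : M) := by
    intro Δ g hg
    refine OMinSys.subst (e := fun v => Sum.elim (g v).1 fun _ => (g v).2) hψ ?_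
    rintro (i | _)
    exacts [hg.1 i, hg.2]
  obtain ⟨K, hK⟩ := exists_uniform_cuts
    (S := fun a x => ψ.Realize fun o => ((Sum.elim a (fun _ : Unit => x) o : Set.Iio e) : M)) hS
  refine ⟨K, _root_.realize_cutsFormula.2 fun a ha => ?_⟩
  obtain ⟨z, hz⟩ := hK fun i => ⟨a i, ha i⟩
  refine ⟨fun k => z k, fun x y hx hy h => ?_⟩
  have hel : ∀ x : Set.Iio e, (fun o => ((Sum.elim (fun i => ⟨a i, ha i⟩)
      (fun _ : Unit => x) o : Set.Iio e) : M)) = Sum.elim a fun _ => (x : M) := by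
    intro x
    funext o
    rcases o with i | _
    exacts [rfl, rfl]
  have := hz ⟨x, hx⟩ ⟨y, hy⟩ fun p ⟨k, hk⟩ => hk ▸ h (z k) ⟨k, rfl⟩
  rwa [hel, hel] at this

end transfer

open scoped FirstOrder

/-- Let `M` be an almost o-minimal structure that is not o-minimal, and
suppose `M` is downward o-minimal.  Let `N` be an elementary extension of `M` (given by an
elementary embedding `f : M ↪ₑ[L] N` of ordered `L`-structures) in which `M` is cofinal,
i.e. every element of `N` is `≤ f x` for some `x ∈ M`.  Then `N` is downward o-minimal. -/
theorem downward_ominimal_of_cofinal_elementary_extension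
    {L : FirstOrder.Language.{u, v}} [L.IsOrdered] {M : Type w}
    [LinearOrder M] [L.Structure M] [L.OrderedStructure M]
    [DenselyOrdered M] [NoMinOrder M] [NoMaxOrder M]
    {N : Type x} [LinearOrder N] [L.Structure N] [L.OrderedStructure N]
    (halmost : IsAlmostOMinimal L M) (hnotomin : ¬ IsOMinimal L M)
    (hdown : IsDownwardOMinimal L M)
    (f : M ↪ₑ[L] N) (hcofinal : ∀ y : N, ∃ x : M, y ≤ f x) :
    IsDownwardOMinimal L N := by
  have hmono : ∀ x y, x < y → f x < f y := fun x y hxy =>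
    (realize_ltVar (L := L) false true (f ∘ fun b => bif b then y else x)).1
      ((f.map_formula _ _).2 ((realize_ltVar (L := L) _ _ _).2 hxy))
  rintro s hs ⟨c, hc⟩
  obtain ⟨A₀, -, hA₀⟩ := Set.definable_iff_finitely_definable.1 hs
  obtain ⟨φ, hφ⟩ := Set.definable_iff_exists_formula_sum.1 hA₀
  have hφ' : ∀ x, x ∈ s ↔ φ.Realize (Sum.elim (fun i => (i : N)) fun _ => x) := fun x => by
    simpa using Set.ext_iff.1 hφ fun _ => x
  obtain ⟨e, he⟩ : ∃ e : M, ∀ p ∈ insert c A₀, p < f e := by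
    have : Nonempty N := ⟨c⟩
    obtain ⟨d, hd⟩ := (insert c A₀).exists_le
    obtain ⟨e₀, he₀⟩ := hcofinal d
    obtain ⟨e, he⟩ := exists_gt e₀
    exact ⟨e, fun p hp => ((hd p hp).trans he₀).trans_lt (hmono _ _ he)⟩
  let g := A₀.equivFin
  obtain ⟨K, hK⟩ := hdown.realize_cutsFormula e (φ.relabel (Sum.map g fun _ => ()))
  rw [← f.map_formula] at hK
  obtain ⟨z, hz⟩ := realize_cutsFormula.1 hK (fun i => (g.symm i : N))
    fun i => he _ (Finset.mem_insert_of_mem (g.symm i).2)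
  have hrel : ∀ x : N, Sum.elim (fun i => (g.symm i : N)) (fun _ : Unit => x) ∘
      Sum.map g (fun _ : Fin 1 => ()) = Sum.elim (fun i : A₀ => (i : N)) fun _ => x := by
    intro x
    funext o
    rcases o with i | _
    · exact congrArg Subtype.val (g.symm_apply_apply i)
    · rfl
  have hlt : ∀ x ∈ s, x < f e := fun x hx => (hc hx).trans_lt (he c (Finset.mem_insert_self _ _))
  refine isFinUnionPointsIntervals_of_cuts (F := insert (f e) (Finset.univ.image z))
    fun x y h => ?_
  have hxy := (h (f e) (Finset.mem_insert_self _ _)).1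
  by_cases hx : x < f e
  · have := hz x y hx (hxy.1 hx) fun p ⟨k, hk⟩ => h p (Finset.mem_insert_of_mem
      (Finset.mem_image.2 ⟨k, Finset.mem_univ k, hk⟩))
    simp only [Formula.realize_relabel, hrel] at this
    exact (hφ' x).trans (this.trans (hφ' y).symm)
  · exact iff_of_false (fun hxs => hx (hlt x hxs)) fun hys => hx (hxy.2 (hlt y hys))
end
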